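/- arXiv:math/0502082 — 6 statements merged into one kernel-verified Lean document; each statement's English description precedes it below -/
import Mathlib

section
/- Let n, r, m be positive integers. For every setoid A on Fin r and every setoid B on Fin m, the product m_A · m_B in the free algebra F_n equals the sum of m_C over all setoids C on Fin (r+m) such that ℓ(C) ≤ n and the meet of C with J equals A|B, where J is the setoid on Fin (r+m) whose two classes are {0,…,r−1} and {r,…,r+m−1}, the meet of two setoids relates a,b iff both setoids relate a,b, and A|B is the setoid on Fin (r+m) relating a,b iff either a,b < r and A relates a,b, or a,b ≥ r and B relates a−r, b−r. -/
open scoped Classical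

noncomputable section

/-- The word `x_{i 0} x_{i 1} ⋯ x_{i (m-1)}` in the free algebra `F_n`. -/
def word (n m : ℕ) (i : Fin m → Fin n) : FreeAlgebra ℚ (Fin n) :=
  (List.ofFn fun j => FreeAlgebra.ι ℚ (i j)).prod

/-- The monomial symmetric function in noncommuting variables indexed by
a set partition (setoid) `A` of `Fin m`. -/
def mSym (n m : ℕ) (A : Setoid (Fin m)) : FreeAlgebra ℚ (Fin n) :=
  ∑ i : Fin m → Fin n, if Setoid.ker i = A then word n m i else 0

/-- The length of a set partition: the number of equivalence classes. -/
def slen {m : ℕ} (A : Setoid (Fin m)) : ℕ := Nat.card (Quotient A)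

/-- The setoid `A|B` on `Fin (r+m)`: `a, b` are related iff either both are `< r`
and `A` relates them, or both are `≥ r` and `B` relates `a-r, b-r`. -/
def sbar {r m : ℕ} (A : Setoid (Fin r)) (B : Setoid (Fin m)) : Setoid (Fin (r + m)) :=
  Setoid.comap finSumFinEquiv.symm
    (Setoid.ker (Sum.map (Quotient.mk A) (Quotient.mk B)))

/-- The setoid `J` on `Fin (r+m)` with the two classes `{0,…,r−1}` and `{r,…,r+m−1}`. -/
def sJ (r m : ℕ) : Setoid (Fin (r + m)) :=
  Setoid.ker fun a : Fin (r + m) => decide ((a : ℕ) < r)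

end

theorem word_mul_word {n r m : ℕ} (i : Fin r → Fin n) (j : Fin m → Fin n) :
    word n r i * word n m j = word n (r + m) (Fin.append i j) := by
  simp only [word]
  rw [← List.prod_append, ← List.ofFn_fin_append]
  congr 2
  funext k
  refine Fin.addCases (fun a => ?_) (fun a => ?_) k <;> simp

theorem slen_ker_le {n m : ℕ} (i : Fin m → Fin n) : slen (Setoid.ker i) ≤ n := by
  simpa [slen] using Nat.card_le_card_of_injective _ (Setoid.kerLift_injective i)

theorem sJ_rel {r m : ℕ} (a b : Fin (r + m)) :
    sJ r m a b ↔ decide ((a : ℕ) < r) = decide ((b : ℕ) < r) :=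
  Iff.rfl

theorem sbar_rel {r m : ℕ} (A : Setoid (Fin r)) (B : Setoid (Fin m)) (a b : Fin (r + m)) :
    sbar A B a b ↔
      Sum.map (Quotient.mk A) (Quotient.mk B) (finSumFinEquiv.symm a) =
        Sum.map (Quotient.mk A) (Quotient.mk B) (finSumFinEquiv.symm b) :=
  Iff.rfl

theorem sbar_castAdd_castAdd {r m : ℕ} (A : Setoid (Fin r)) (B : Setoid (Fin m)) (a b : Fin r) :
    sbar A B (Fin.castAdd m a) (Fin.castAdd m b) ↔ A a b := by
  simp [sbar_rel, Quotient.eq]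

theorem sbar_natAdd_natAdd {r m : ℕ} (A : Setoid (Fin r)) (B : Setoid (Fin m)) (a b : Fin m) :
    sbar A B (Fin.natAdd r a) (Fin.natAdd r b) ↔ B a b := by
  simp [sbar_rel, Quotient.eq]

theorem not_sbar_castAdd_natAdd {r m : ℕ} (A : Setoid (Fin r)) (B : Setoid (Fin m))
    (a : Fin r) (b : Fin m) : ¬ sbar A B (Fin.castAdd m a) (Fin.natAdd r b) := by
  simp [sbar_rel]

theorem ker_append_inf_sJ_eq_sbar_iff {α : Type*} {r m : ℕ} (A : Setoid (Fin r))
    (B : Setoid (Fin m)) (i : Fin r → α) (j : Fin m → α) :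
    Setoid.ker (Fin.append i j) ⊓ sJ r m = sbar A B ↔
      Setoid.ker i = A ∧ Setoid.ker j = B := by
  constructor
  · intro h
    constructor
    · ext a b
      rw [← sbar_castAdd_castAdd A B, ← h]
      simp [Setoid.inf_iff_and, sJ_rel, Setoid.ker_def]
    · ext a b
      rw [← sbar_natAdd_natAdd A B, ← h]
      simp [Setoid.inf_iff_and, sJ_rel, Setoid.ker_def]
  · rintro ⟨rfl, rfl⟩
    ext x y
    induction x using Fin.addCases with
    | left a =>
      induction y using Fin.addCases with
      | left b =>
        rw [sbar_castAdd_castAdd]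
        simp [Setoid.inf_iff_and, sJ_rel, Setoid.ker_def]
      | right b =>
        simp [not_sbar_castAdd_natAdd, Setoid.inf_iff_and, sJ_rel, Setoid.ker_def]
    | right a =>
      induction y using Fin.addCases with
      | left b =>
        rw [Setoid.comm', Setoid.comm' (sbar _ _)]
        simp [not_sbar_castAdd_natAdd, Setoid.inf_iff_and, sJ_rel, Setoid.ker_def]
      | right b =>
        rw [sbar_natAdd_natAdd]
        simp [Setoid.inf_iff_and, sJ_rel, Setoid.ker_def]

/-- The product `m_A · m_B` in `F_n` equals the sum of `m_C` over all set
partitions `C` of `[r+m]` with `ℓ(C) ≤ n` and `C ⊓ J = A|B`. -/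
theorem stmt0 (n r m : ℕ) (hn : 0 < n) (hr : 0 < r) (hm : 0 < m)
    (A : Setoid (Fin r)) (B : Setoid (Fin m)) :
    mSym n r A * mSym n m B =
      ∑ᶠ C : Setoid (Fin (r + m)),
        if slen C ≤ n ∧ C ⊓ sJ r m = sbar A B then mSym n (r + m) C else 0 := by
  have : Finite (Setoid (Fin (r + m))) :=
    Finite.of_injective (fun C : Setoid (Fin (r + m)) => fun a b => C a b)
      fun C D h => Setoid.ext fun a b => iff_of_eq (congrFun (congrFun h a) b)
  have := Fintype.ofFinite (Setoid (Fin (r + m)))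
  have hmul : mSym n r A * mSym n m B =
      ∑ k : Fin (r + m) → Fin n,
        if Setoid.ker k ⊓ sJ r m = sbar A B then word n (r + m) k else 0 := by
    rw [← (Fin.appendEquiv r m).sum_comp, Fintype.sum_prod_type]
    simp only [mSym, Finset.sum_mul_sum, Fin.appendEquiv, Equiv.coe_fn_mk,
      ker_append_inf_sJ_eq_sbar_iff, ← word_mul_word]
    refine Finset.sum_congr rfl fun i _ => Finset.sum_congr rfl fun j _ => ?_
    by_cases hi : Setoid.ker i = A <;> by_cases hj : Setoid.ker j = B <;> simp [hi, hj]
  have hterm (C : Setoid (Fin (r + m))) :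
      (if slen C ≤ n ∧ C ⊓ sJ r m = sbar A B then mSym n (r + m) C else 0) =
        ∑ k : Fin (r + m) → Fin n, if C = Setoid.ker k then
          (if Setoid.ker k ⊓ sJ r m = sbar A B then word n (r + m) k else 0) else 0 := by
    by_cases hP : slen C ≤ n ∧ C ⊓ sJ r m = sbar A B
    · rw [if_pos hP, mSym]
      refine Finset.sum_congr rfl fun k _ => ?_
      by_cases hC : C = Setoid.ker k
      · subst hC
        simp [hP.2]
      · simp [hC, Ne.symm hC]
    · rw [if_neg hP]
      refine (Finset.sum_eq_zero fun k _ => ?_).symm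
      by_cases hC : C = Setoid.ker k
      · subst hC
        rw [if_pos rfl, if_neg fun h => hP ⟨slen_ker_le k, h⟩]
      · rw [if_neg hC]
  rw [hmul, finsum_eq_sum_of_fintype]
  simp_rw [hterm]
  rw [Finset.sum_comm]
  simp
end

section
/- Let n ≥ 1, k ≥ 0, and let A be a setoid on Fin k. In the tensor product algebra F_n ⊗_ℚ F_n, for each function i : Fin k → Fin n ⊕ Fin n let z_i be the ordered product over j = 0,…,k−1 of ζ(i(j)), where ζ(inl a) = x_a ⊗ 1 and ζ(inr a) = 1 ⊗ x_a. Then ∑_{i : ker(i) = A} z_i = ∑_S m_{A_S} ⊗ m_{A_{S^c}}, where the sum runs over all subsets S of the set of equivalence classes of A, S^c is the complementary set of classes, and for a set S of classes whose union T ⊆ Fin k has cardinality t, A_S denotes the setoid on Fin t obtained by restricting A to T and transporting it along the unique order isomorphism Fin t ≃ T. -/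
open scoped Classical TensorProduct

noncomputable section

/-- `ζ (inl a) = x_a ⊗ 1` and `ζ (inr a) = 1 ⊗ x_a` in `F_n ⊗ F_n`. -/
def zeta (n : ℕ) : Fin n ⊕ Fin n → FreeAlgebra ℚ (Fin n) ⊗[ℚ] FreeAlgebra ℚ (Fin n)
  | Sum.inl a => FreeAlgebra.ι ℚ a ⊗ₜ[ℚ] 1
  | Sum.inr a => 1 ⊗ₜ[ℚ] FreeAlgebra.ι ℚ a

/-- For `i : Fin k → Fin n ⊕ Fin n`, the ordered product `ζ(i 0) ζ(i 1) ⋯ ζ(i (k-1))`. -/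
def zWord (n k : ℕ) (i : Fin k → Fin n ⊕ Fin n) :
    FreeAlgebra ℚ (Fin n) ⊗[ℚ] FreeAlgebra ℚ (Fin n) :=
  (List.ofFn fun j => zeta n (i j)).prod

/-- The union `T ⊆ Fin k` of the set `S` of equivalence classes of `A`, as a `Finset`. -/
def classT {k : ℕ} (A : Setoid (Fin k)) (S : Set (Quotient A)) : Finset (Fin k) :=
  Finset.univ.filter fun x => (Quotient.mk A x : Quotient A) ∈ S

/-- The standardization `A_S`: the restriction of `A` to the union `T` of the classes in `S`,
transported along the unique order isomorphism `Fin T.card ≃ T`. -/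
def stand {k : ℕ} (A : Setoid (Fin k)) (S : Set (Quotient A)) :
    Setoid (Fin (classT A S).card) :=
  Setoid.comap (fun j => (((classT A S).orderIsoOfFin rfl) j : Fin k)) A

end

theorem finRange_filter_mem {k : ℕ} (T : Finset (Fin k)) :
    (List.finRange k).filter (fun j => j ∈ T) =
      List.ofFn fun a => ((T.orderIsoOfFin rfl) a : Fin k) := by
  refine List.Perm.eq_of_pairwise' (r := (· < ·)) ?_ ?_ ?_
  · exact (List.pairwise_lt_finRange k).filter _
  · rw [List.pairwise_ofFn]
    exact fun i j h => (T.orderIsoOfFin rfl).strictMono h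
  · rw [List.perm_ext_iff_of_nodup ((List.nodup_finRange k).filter _)
      (List.nodup_ofFn.2 fun a b hab =>
        (T.orderIsoOfFin rfl).injective (Subtype.val_injective hab))]
    intro x
    simp only [List.mem_filter, List.mem_finRange, true_and, decide_eq_true_eq, List.mem_ofFn]
    exact ⟨fun h => ⟨(T.orderIsoOfFin rfl).symm ⟨x, h⟩, by simp⟩,
      fun ⟨a, h⟩ => h ▸ ((T.orderIsoOfFin rfl) a).2⟩

theorem filterMap_ofFn {α β : Type*} {k : ℕ} (T : Finset (Fin k)) (p : α → Option β)
    (i : Fin k → α) (f : Fin T.card → β) (hf : ∀ a, p (i (T.orderIsoOfFin rfl a)) = some (f a))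
    (hn : ∀ j, j ∉ T → p (i j) = none) :
    (List.ofFn i).filterMap p = List.ofFn f := by
  have h : (List.finRange k).filterMap (p ∘ i) =
      ((List.finRange k).filter (fun j => j ∈ T)).filterMap (p ∘ i) := by
    rw [List.filterMap_filter]
    refine List.filterMap_congr fun j _ => ?_
    by_cases hj : j ∈ T <;> simp [hj, hn]
  rw [List.ofFn_eq_map, List.filterMap_map, h, finRange_filter_mem, List.ofFn_eq_map,
    List.filterMap_map, List.ofFn_eq_map, ← List.filterMap_eq_map]
  exact List.filterMap_congr fun a _ => hf a

theorem prod_map_zeta (n : ℕ) (L : List (Fin n ⊕ Fin n)) :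
    (L.map (zeta n)).prod =
      ((L.filterMap Sum.getLeft?).map (FreeAlgebra.ι ℚ)).prod ⊗ₜ[ℚ]
        ((L.filterMap Sum.getRight?).map (FreeAlgebra.ι ℚ)).prod := by
  induction L with
  | nil => simp [Algebra.TensorProduct.one_def]
  | cons a L ih => cases a <;> simp [ih, zeta, List.filterMap_cons]

/-- The function equal to `f` on `T` and to `g` off `T`, both read in increasing order. -/
def shuffle {k : ℕ} {β γ : Type*} (T T' : Finset (Fin k)) (h : ∀ j, j ∉ T → j ∈ T')
    (f : Fin T.card → β) (g : Fin T'.card → γ) (j : Fin k) : β ⊕ γ :=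
  if hj : j ∈ T then Sum.inl (f ((T.orderIsoOfFin rfl).symm ⟨j, hj⟩))
  else Sum.inr (g ((T'.orderIsoOfFin rfl).symm ⟨j, h j hj⟩))

section shuffle

variable {k : ℕ} {β γ : Type*} {T T' : Finset (Fin k)} (h : ∀ j, j ∉ T ↔ j ∈ T')
  (f : Fin T.card → β) (g : Fin T'.card → γ)

theorem shuffle_left (a : Fin T.card) :
    shuffle T T' (fun j => (h j).1) f g (T.orderIsoOfFin rfl a) = Sum.inl (f a) := by
  simp only [shuffle, dif_pos (T.orderIsoOfFin rfl a).2, Subtype.coe_eta,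
    OrderIso.symm_apply_apply]

theorem shuffle_right (b : Fin T'.card) :
    shuffle T T' (fun j => (h j).1) f g (T'.orderIsoOfFin rfl b) = Sum.inr (g b) := by
  simp only [shuffle, dif_neg ((h _).2 (T'.orderIsoOfFin rfl b).2), Subtype.coe_eta,
    OrderIso.symm_apply_apply]

theorem exists_orderIsoOfFin (T : Finset (Fin k)) {j : Fin k} (hj : j ∈ T) :
    ∃ a, (T.orderIsoOfFin rfl a : Fin k) = j :=
  ⟨(T.orderIsoOfFin rfl).symm ⟨j, hj⟩, by simp⟩

theorem isLeft_shuffle (j : Fin k) :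
    (shuffle T T' (fun j => (h j).1) f g j).isLeft ↔ j ∈ T := by
  by_cases hj : j ∈ T <;> simp [shuffle, hj]

theorem zWord_shuffle {n : ℕ} (f : Fin T.card → Fin n) (g : Fin T'.card → Fin n) :
    zWord n k (shuffle T T' (fun j => (h j).1) f g) = word n _ f ⊗ₜ[ℚ] word n _ g := by
  have hz (i : Fin k → Fin n ⊕ Fin n) : zWord n k i = ((List.ofFn i).map (zeta n)).prod := by
    rw [List.map_ofFn]; rfl
  have hw (m : ℕ) (i : Fin m → Fin n) :
      word n m i = ((List.ofFn i).map (FreeAlgebra.ι ℚ)).prod := by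
    rw [List.map_ofFn]; rfl
  rw [hz, hw, hw, prod_map_zeta, filterMap_ofFn T _ _ f, filterMap_ofFn T' _ _ g]
  · intro b
    rw [shuffle_right h]; rfl
  · intro j hj
    obtain ⟨a, rfl⟩ := exists_orderIsoOfFin T (not_not.1 fun hT => hj ((h j).1 hT))
    rw [shuffle_left h]; rfl
  · intro a
    rw [shuffle_left h]; rfl
  · intro j hj
    obtain ⟨b, rfl⟩ := exists_orderIsoOfFin T' ((h j).1 hj)
    rw [shuffle_right h]; rfl

theorem shuffle_injective :
    Function.Injective fun p : (Fin T.card → β) × (Fin T'.card → γ) =>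
      shuffle T T' (fun j => (h j).1) p.1 p.2 := by
  rintro ⟨f, g⟩ ⟨f', g'⟩ hp
  refine Prod.ext (funext fun a => ?_) (funext fun b => ?_)
  · have := congrFun hp (T.orderIsoOfFin rfl a)
    simpa only [shuffle_left h, Sum.inl.injEq] using this
  · have := congrFun hp (T'.orderIsoOfFin rfl b)
    simpa only [shuffle_right h, Sum.inr.injEq] using this

theorem exists_shuffle_eq (i : Fin k → β ⊕ γ) (hi : ∀ j, (i j).isLeft ↔ j ∈ T) :
    ∃ f g, shuffle T T' (fun j => (h j).1) f g = i := by
  have hl (a : Fin T.card) : ∃ b, i (T.orderIsoOfFin rfl a) = Sum.inl b :=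
    Sum.isLeft_iff.1 ((hi _).2 (T.orderIsoOfFin rfl a).2)
  have hr (a : Fin T'.card) : ∃ c, i (T'.orderIsoOfFin rfl a) = Sum.inr c := by
    rw [← Sum.isRight_iff, ← Sum.not_isLeft, hi]
    exact (h _).2 (T'.orderIsoOfFin rfl a).2
  choose f hf using hl
  choose g hg using hr
  refine ⟨f, g, funext fun j => ?_⟩
  by_cases hj : j ∈ T
  · obtain ⟨a, rfl⟩ := exists_orderIsoOfFin T hj
    rw [shuffle_left h, hf]
  · obtain ⟨b, rfl⟩ := exists_orderIsoOfFin T' ((h j).1 hj)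
    rw [shuffle_right h, hg]

end shuffle

theorem mem_classT {k : ℕ} (A : Setoid (Fin k)) (S : Set (Quotient A)) (j : Fin k) :
    j ∈ classT A S ↔ Quotient.mk A j ∈ S := by
  simp [classT]

theorem notMem_classT_iff {k : ℕ} (A : Setoid (Fin k)) (S : Set (Quotient A)) (j : Fin k) :
    j ∉ classT A S ↔ j ∈ classT A Sᶜ := by
  simp [mem_classT]

theorem ker_shuffle_eq_iff {k : ℕ} {β γ : Type*} (A : Setoid (Fin k)) (S : Set (Quotient A))
    (f : Fin (classT A S).card → β) (g : Fin (classT A Sᶜ).card → γ) :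
    Setoid.ker (shuffle _ _ (fun j => (notMem_classT_iff A S j).1) f g) = A ↔
      Setoid.ker f = stand A S ∧ Setoid.ker g = stand A Sᶜ := by
  have h := notMem_classT_iff A S
  have hmk {x y : Fin k} (hxy : A x y) : x ∈ classT A S ↔ y ∈ classT A S := by
    rw [mem_classT, mem_classT, Quotient.sound (s := A) hxy]
  simp only [Setoid.ext_iff, Setoid.ker_def, stand, Setoid.comap_rel]
  constructor
  · intro hA
    refine ⟨fun a b => ?_, fun a b => ?_⟩
    · rw [← hA, shuffle_left h, shuffle_left h, Sum.inl.injEq]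
    · rw [← hA, shuffle_right h, shuffle_right h, Sum.inr.injEq]
  · rintro ⟨hf, hg⟩ x y
    by_cases hx : x ∈ classT A S <;> by_cases hy : y ∈ classT A S
    · obtain ⟨a, rfl⟩ := exists_orderIsoOfFin _ hx
      obtain ⟨b, rfl⟩ := exists_orderIsoOfFin _ hy
      rw [shuffle_left h, shuffle_left h, Sum.inl.injEq, hf]
    · simp only [shuffle, dif_pos hx, dif_neg hy, reduceCtorEq, false_iff]
      exact fun hxy => hy ((hmk hxy).1 hx)
    · simp only [shuffle, dif_pos hy, dif_neg hx, reduceCtorEq, false_iff]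
      exact fun hxy => hx ((hmk hxy).2 hy)
    · obtain ⟨a, rfl⟩ := exists_orderIsoOfFin _ ((h x).1 hx)
      obtain ⟨b, rfl⟩ := exists_orderIsoOfFin _ ((h y).1 hy)
      rw [shuffle_right h, shuffle_right h, Sum.inr.injEq, hg]

theorem mSym_tmul_mSym (n : ℕ) {k : ℕ} (A : Setoid (Fin k)) (S : Set (Quotient A)) :
    mSym n _ (stand A S) ⊗ₜ[ℚ] mSym n _ (stand A Sᶜ) =
      ∑ i : Fin k → Fin n ⊕ Fin n,
        if Setoid.ker i = A ∧ ∀ j, (i j).isLeft ↔ j ∈ classT A S then zWord n k i else 0 := by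
  have h := notMem_classT_iff A S
  rw [mSym, mSym, TensorProduct.sum_tmul]
  simp only [TensorProduct.tmul_sum]
  rw [← Fintype.sum_prod_type']
  refine Finset.sum_of_injOn (fun p => shuffle _ _ (fun j => (h j).1) p.1 p.2)
    (shuffle_injective h).injOn (fun _ _ => Finset.mem_coe.2 (Finset.mem_univ _)) ?_ ?_
  · intro i _ hi
    refine if_neg fun hc => hi ?_
    obtain ⟨f, g, hfg⟩ := exists_shuffle_eq h i hc.2
    exact ⟨(f, g), by simp, hfg⟩
  · rintro ⟨f, g⟩ -
    simp only [ker_shuffle_eq_iff, isLeft_shuffle h, zWord_shuffle h, implies_true, and_true]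
    by_cases hf : Setoid.ker f = stand A S <;> by_cases hg : Setoid.ker g = stand A Sᶜ <;>
      simp [hf, hg]

theorem existsUnique_isLeft_classT {k : ℕ} {β γ : Type*} (i : Fin k → β ⊕ γ) :
    ∃! S : Set (Quotient (Setoid.ker i)), ∀ j, (i j).isLeft ↔ j ∈ classT _ S := by
  refine ⟨{q | Quotient.lift (fun j => ((i j).isLeft : Prop))
    (fun a b (hab : i a = i b) => by simp only [hab]) q}, fun j => ?_, fun S hS => ?_⟩
  · rw [mem_classT]; rfl
  · ext q
    induction q using Quotient.inductionOn with
    | h j => rw [← mem_classT, ← hS]; rfl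

/-- In `F_n ⊗ F_n`, `∑_{i : ker i = A} z_i = ∑_S m_{A_S} ⊗ m_{A_{Sᶜ}}`, where `S` runs over
all subsets of the set of equivalence classes of `A`. -/
theorem stmt2 (n k : ℕ) (hn : 1 ≤ n) (A : Setoid (Fin k)) :
    (∑ i : Fin k → Fin n ⊕ Fin n, if Setoid.ker i = A then zWord n k i else 0) =
      ∑ᶠ S : Set (Quotient A),
        mSym n (classT A S).card (stand A S) ⊗ₜ[ℚ] mSym n (classT A Sᶜ).card (stand A Sᶜ) := by
  rw [finsum_eq_sum_of_fintype]
  simp only [mSym_tmul_mSym]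
  rw [Finset.sum_comm]
  refine Finset.sum_congr rfl fun i _ => ?_
  by_cases hA : Setoid.ker i = A
  · subst hA
    obtain ⟨S, hS, hu⟩ := existsUnique_isLeft_classT i
    rw [Finset.sum_eq_single S]
    · rw [if_pos rfl, if_pos ⟨rfl, hS⟩]
    · exact fun S' _ hne => if_neg fun hc => hne (hu S' hc.2)
    · exact fun hS' => absurd (Finset.mem_univ S) hS'
  · simp [hA]
end

section
/- Let m ≥ 1 and n ≥ m. For k ≥ 1 define h̃_k := ∑_{A setoid on Fin k} (λ(A)!/k!) · m_A ∈ F_n, where λ(A)! is the product of the factorials of the sizes of the equivalence classes of A, and for a composition α of m let H_α := h̃_{α_1} h̃_{α_2} ⋯ h̃_{α_{ℓ(α)}}. Then the family (H_α), indexed by all compositions α of m, is linearly independent over ℚ in F_n. -/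
open scoped Classical

noncomputable section

/-- `λ(A)!`: the product of the factorials of the sizes of the equivalence classes of `A`. -/
def lamFact {k : ℕ} (A : Setoid (Fin k)) : ℕ :=
  ∏ᶠ c : Quotient A, (Nat.card {x : Fin k // (Quotient.mk A x : Quotient A) = c}).factorial

/-- `h̃_k = ∑_A (λ(A)!/k!) · m_A`, the lift of the complete homogeneous symmetric function. -/
def htilde (n k : ℕ) : FreeAlgebra ℚ (Fin n) :=
  ∑ᶠ A : Setoid (Fin k), ((lamFact A : ℚ) / (k.factorial : ℚ)) • mSym n k A

/-- `H_α = h̃_{α_1} h̃_{α_2} ⋯ h̃_{α_{ℓ(α)}}`. -/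
def Hcomp (n : ℕ) {m : ℕ} (α : Composition m) : FreeAlgebra ℚ (Fin n) :=
  (List.ofFn fun j : Fin α.length => htilde n (α.blocksFun j)).prod


end


/-! ### Words -/

theorem linearIndependent_word (n m : ℕ) : LinearIndependent ℚ (word n m) := by
  have hword : word n m =
      FreeAlgebra.basisFreeMonoid ℚ (Fin n) ∘ fun i => FreeMonoid.ofList (List.ofFn i) := by
    funext i
    have h : FreeAlgebra.basisFreeMonoid ℚ (Fin n) (FreeMonoid.ofList (List.ofFn i)) =
        FreeAlgebra.equivMonoidAlgebraFreeMonoid.symm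
          (MonoidAlgebra.of ℚ (FreeMonoid (Fin n)) (FreeMonoid.ofList (List.ofFn i))) := rfl
    rw [Function.comp_apply, h, AlgEquiv.eq_symm_apply]
    rw [word, map_list_prod, List.map_ofFn]
    have hι (x : Fin n) : FreeAlgebra.equivMonoidAlgebraFreeMonoid (FreeAlgebra.ι ℚ x) =
        MonoidAlgebra.of ℚ (FreeMonoid (Fin n)) (FreeMonoid.of x) :=
      FreeAlgebra.lift_ι_apply _ _
    simp_rw [Function.comp_def, hι]
    have hprod (l : List (Fin n)) : (l.map FreeMonoid.of).prod = FreeMonoid.ofList l := by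
      induction l with
      | nil => rfl
      | cons x l ih => rw [List.map_cons, List.prod_cons, ih]; rfl
    rw [← hprod, map_list_prod, List.map_map, List.map_ofFn]
    rfl
  rw [hword]
  refine (FreeAlgebra.basisFreeMonoid ℚ (Fin n)).linearIndependent.comp _ ?_
  exact FreeMonoid.ofList.injective.comp List.ofFn_injective

theorem List.prod_ofFn_sum {R : Type*} [Semiring R] {r : ℕ} {ι : Fin r → Type*}
    [∀ j, Fintype (ι j)] (f : ∀ j, ι j → R) :
    (List.ofFn fun j => ∑ u, f j u).prod = ∑ u : ∀ j, ι j, (List.ofFn fun j => f j (u j)).prod := by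
  induction r with
  | zero => simp
  | succ r ih =>
    rw [List.ofFn_succ, List.prod_cons, ih, Finset.sum_mul_sum, ← Fintype.sum_prod_type',
      ← (Fin.consEquiv ι).sum_comp]
    simp [List.ofFn_succ, Fin.consEquiv]

theorem List.prod_ofFn_smul {R A : Type*} [CommSemiring R] [Semiring A] [Algebra R A] {r : ℕ}
    (c : Fin r → R) (f : Fin r → A) :
    (List.ofFn fun j => c j • f j).prod = (∏ j, c j) • (List.ofFn f).prod := by
  induction r with
  | zero => simp
  | succ r ih => simp [List.ofFn_succ, ih, Fin.prod_univ_succ, smul_smul, mul_comm]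

theorem Composition.splitWrtComposition_ofFn {X : Type*} {m : ℕ} (α : Composition m)
    (w : Fin m → X) : (List.ofFn w).splitWrtComposition α =
      List.ofFn fun j => List.ofFn fun t => w (α.embedding j t) := by
  refine List.ext_getElem (by simp) fun i h₁ h₂ => ?_
  have hi : i < α.length := by simpa using h₂
  have hle : α.sizeUpTo (i + 1) ≤ m := α.sizeUpTo_le _
  have hs : α.sizeUpTo (i + 1) = α.sizeUpTo i + α.blocksFun ⟨i, hi⟩ := α.sizeUpTo_succ hi
  rw [List.getElem_splitWrtComposition, List.getElem_ofFn]
  refine List.ext_getElem (by simp; omega) fun t ht₁ ht₂ => ?_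
  simp only [List.getElem_drop, List.getElem_take, List.getElem_ofFn]
  rfl

theorem word_eq_prod_word_comp_embedding (n : ℕ) {m : ℕ} (α : Composition m) (w : Fin m → Fin n) :
    word n m w = (List.ofFn fun j => word n _ (w ∘ α.embedding j)).prod := by
  have h := List.flatten_splitWrtCompositionAux (ns := α.blocks)
    (l := List.ofFn fun j => FreeAlgebra.ι ℚ (w j)) (by simp)
  rw [word, ← h, List.prod_flatten]
  have h' := α.splitWrtComposition_ofFn fun j => FreeAlgebra.ι ℚ (w j)
  rw [List.splitWrtComposition] at h'
  rw [h', List.map_ofFn]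
  rfl

instance Setoid.instFiniteOfFinite {X : Type*} [Finite X] : Finite (Setoid X) :=
  Finite.of_injective (fun A : Setoid X => fun a b => A a b) fun _ _ h =>
    Setoid.ext fun a b => iff_of_eq (congrFun (congrFun h a) b)

theorem htilde_eq_sum_word (n k : ℕ) : htilde n k =
    ∑ u : Fin k → Fin n, ((lamFact (Setoid.ker u) : ℚ) / k.factorial) • word n k u := by
  have := Fintype.ofFinite (Setoid (Fin k))
  rw [htilde, finsum_eq_sum_of_fintype]
  simp_rw [mSym, Finset.smul_sum, smul_ite, smul_zero]
  rw [Finset.sum_comm]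
  simp

/-- Restricting a word to the blocks of a composition. -/
def Composition.piBlocksEquiv {m : ℕ} (α : Composition m) (X : Type*) :
    (Fin m → X) ≃ (∀ j : Fin α.length, Fin (α.blocksFun j) → X) :=
  (α.blocksFinEquiv.symm.arrowCongr (Equiv.refl X)).trans (Equiv.piCurry fun _ _ => X)

theorem Hcomp_eq_sum_word (n : ℕ) {m : ℕ} (α : Composition m) : Hcomp n α =
    ∑ w : Fin m → Fin n, (∏ j, ((lamFact (Setoid.ker (w ∘ α.embedding j)) : ℚ) /
      (α.blocksFun j).factorial)) • word n m w := by
  simp_rw [Hcomp, htilde_eq_sum_word, List.prod_ofFn_sum, List.prod_ofFn_smul]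
  rw [← (α.piBlocksEquiv (Fin n)).sum_comp]
  refine Finset.sum_congr rfl fun w _ => ?_
  rw [word_eq_prod_word_comp_embedding n α w]
  rfl

/-! ### Counting permutations preserving the classes of a setoid -/

theorem lamFact_eq_card {k : ℕ} (A : Setoid (Fin k)) :
    lamFact A = Nat.card {g : Equiv.Perm (Fin k) // ∀ a, A (g a) a} := by
  rw [lamFact, finprod_eq_prod_of_fintype]
  have h := DomMulAct.stabilizer_card (Quotient.mk A)
  simp_rw [Nat.card_eq_fintype_card]
  convert h.symm using 2
  refine congrArg Subtype (funext fun g => propext ?_)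
  simp [funext_iff, Quotient.eq]

theorem lamFact_ker {k : ℕ} {Y : Type*} [Fintype Y] (f : Fin k → Y) :
    lamFact (Setoid.ker f) = ∏ y, (Nat.card {a // f a = y}).factorial := by
  simp_rw [lamFact_eq_card, Nat.card_eq_fintype_card]
  rw [← DomMulAct.stabilizer_card f]
  refine Fintype.card_congr (Equiv.subtypeEquivRight fun g => ?_)
  rw [funext_iff]; rfl

theorem prod_lamFact_ker_comp_embedding {m : ℕ} {Y : Type*} [Fintype Y] (α : Composition m)
    (w : Fin m → Y) : ∏ j, lamFact (Setoid.ker (w ∘ α.embedding j)) =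
      lamFact (Setoid.ker w ⊓ Setoid.ker α.index) := by
  have h : Setoid.ker w ⊓ Setoid.ker α.index = Setoid.ker fun a => (α.index a, w a) :=
    Setoid.ext fun a b => by
      simp [Setoid.inf_def, Setoid.ker_def, and_comm]
  rw [h, lamFact_ker, Fintype.prod_prod_type]
  refine Finset.prod_congr rfl fun j _ => ?_
  rw [lamFact_ker]
  refine Finset.prod_congr rfl fun y _ => congrArg _ (Nat.card_congr ?_)
  refine Equiv.ofBijective (fun t => ⟨α.embedding j t.1, by simpa using t.2⟩) ⟨?_, ?_⟩
  · intro s t h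
    simpa [Subtype.ext_iff] using h
  · rintro ⟨a, ha⟩
    obtain ⟨rfl, rfl⟩ := Prod.ext_iff.1 ha
    exact ⟨⟨α.invEmbedding a, by simp⟩, by simp⟩

/-- The number of permutations whose orbits are the classes of a given setoid. -/
noncomputable def orbitCount {k : ℕ} (A : Setoid (Fin k)) : ℕ :=
  Nat.card {g : Equiv.Perm (Fin k) // Equiv.Perm.SameCycle.setoid g = A}

theorem sameCycle_setoid_le_iff {X : Type*} (g : Equiv.Perm X) (A : Setoid X) :
    Equiv.Perm.SameCycle.setoid g ≤ A ↔ ∀ a, A (g a) a := by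
  refine ⟨fun h a => A.symm (h (⟨1, by simp⟩ : g.SameCycle a (g a))), fun h a b => ?_⟩
  rintro ⟨i, rfl⟩
  have key : ∀ (i : ℤ) (a : X), A a ((g ^ i) a) := by
    intro i
    induction i with
    | zero => exact fun a => A.refl a
    | succ i ih =>
      intro a
      rw [add_comm, zpow_add, zpow_one]
      exact A.trans (ih a) (A.symm (h _))
    | pred i ih =>
      intro a
      refine A.trans (ih a) ?_
      have := h ((g ^ (-(i : ℤ) - 1)) a)
      rwa [← Equiv.Perm.mul_apply, ← zpow_one_add, add_sub_cancel] at this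
  exact key i a

theorem lamFact_eq_sum_orbitCount {k : ℕ} [Fintype (Setoid (Fin k))] (A : Setoid (Fin k)) :
    lamFact A = ∑ C with C ≤ A, orbitCount C := by
  simp_rw [lamFact_eq_card, orbitCount, ← sameCycle_setoid_le_iff, Nat.card_eq_fintype_card,
    Fintype.card_subtype]
  rw [Finset.card_eq_sum_card_fiberwise
    (f := fun g : Equiv.Perm (Fin k) => Equiv.Perm.SameCycle.setoid g) (t := {C | C ≤ A})
    (by intro g; simp)]
  refine Finset.sum_congr rfl fun C hC => congrArg _ ?_
  ext g
  simp only [Finset.mem_filter, Finset.mem_univ, true_and] at hC ⊢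
  exact ⟨fun h => h.2, fun h => ⟨h ▸ hC, h⟩⟩

theorem Setoid.exists_perm_sameCycle {X : Type*} [Fintype X] (A : Setoid X) :
    ∃ g : Equiv.Perm X, Equiv.Perm.SameCycle.setoid g = A := by
  choose f hf _ using fun c : Quotient A => Finset.exists_cycleOn {a | Quotient.mk A a = c}
  have hmap (a : X) : Quotient.mk A (f (Quotient.mk A a) a) = Quotient.mk A a := by
    have := (hf (Quotient.mk A a)).1.mapsTo (x := a) (by simp)
    simpa using this
  have hinj : Function.Injective fun a => f (Quotient.mk A a) a := by
    intro a b hab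
    have hc : Quotient.mk A a = Quotient.mk A b := by
      rw [← hmap a, ← hmap b]
      exact congrArg _ hab
    simp only [hc] at hab
    exact (f _).injective hab
  let g : Equiv.Perm X := Equiv.ofBijective _ (Finite.injective_iff_bijective.1 hinj)
  have hg (a : X) : g a = f (Quotient.mk A a) a := rfl
  refine ⟨g, le_antisymm ((sameCycle_setoid_le_iff _ _).2 fun a => Quotient.exact (hmap a)) ?_⟩
  intro a b hab
  have hpow (i : ℕ) : (g ^ i) a = (f (Quotient.mk A a) ^ i) a ∧
      Quotient.mk A ((g ^ i) a) = Quotient.mk A a := by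
    induction i with
    | zero => simp
    | succ i ih =>
      rw [pow_succ', Equiv.Perm.mul_apply, pow_succ', Equiv.Perm.mul_apply, hg, hmap, ih.2, ih.1]
      exact ⟨rfl, rfl⟩
  obtain ⟨i, hi⟩ := ((hf (Quotient.mk A a)).2 (x := a) (by simp) (y := b)
    (by simpa using (Quotient.sound hab).symm)).exists_nat_pow_eq
  exact ⟨i, by rw [zpow_natCast, (hpow i).1, hi]⟩

theorem orbitCount_ne_zero {k : ℕ} (A : Setoid (Fin k)) : orbitCount A ≠ 0 := by
  obtain ⟨g, hg⟩ := A.exists_perm_sameCycle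
  have : Nonempty {g : Equiv.Perm (Fin k) // Equiv.Perm.SameCycle.setoid g = A} := ⟨⟨g, hg⟩⟩
  exact Nat.card_pos.ne'

/-! ### Compositions and their interval setoids -/

theorem Composition.index_monotone {m : ℕ} (α : Composition m) : Monotone α.index := by
  intro a b hab
  by_contra! h
  have h₁ := α.lt_sizeUpTo_index_succ b
  have h₂ := α.sizeUpTo_index_le a
  have h₃ : α.sizeUpTo (α.index b).succ ≤ α.sizeUpTo (α.index a) :=
    α.monotone_sizeUpTo (by simpa [Nat.succ_le_iff] using h)
  have h₄ : (a : ℕ) ≤ b := hab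
  simp at h₁ h₃
  omega

theorem Composition.index_surjective {m : ℕ} (α : Composition m) :
    Function.Surjective α.index := fun i =>
  ⟨α.embedding i ⟨0, α.blocks_pos (List.getElem_mem _)⟩, α.index_embedding _ _⟩

theorem Composition.card_image_index_Iic {m : ℕ} (α : Composition m) (a : Fin m) :
    ((Finset.Iic a).image α.index).card = α.index a + 1 := by
  have h : (Finset.Iic a).image α.index = Finset.Iic (α.index a) := by
    ext i
    simp only [Finset.mem_image, Finset.mem_Iic]
    refine ⟨fun ⟨b, hb, h⟩ => h ▸ α.index_monotone hb, fun hi => ?_⟩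
    obtain ⟨b, rfl⟩ := α.index_surjective i
    rcases le_total b a with hb | hb
    · exact ⟨b, hb, rfl⟩
    · exact ⟨a, le_rfl, le_antisymm (α.index_monotone hb) hi⟩
  rw [h, Fin.card_Iic]

theorem Finset.card_image_eq_card_image_mk {X Y : Type*} [DecidableEq Y] {f : X → Y}
    {A : Setoid X} [DecidableEq (Quotient A)] (h : Setoid.ker f = A) (s : Finset X) :
    (s.image f).card = (s.image (Quotient.mk A)).card := by
  subst h
  rw [← Finset.card_image_of_injective _ (Setoid.kerLift_injective f), Finset.image_image]
  rfl

theorem Finset.card_image_eq_of_ker_eq {X Y Z : Type*} [DecidableEq Y] [DecidableEq Z]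
    {f : X → Y} {g : X → Z} (h : Setoid.ker f = Setoid.ker g) (s : Finset X) :
    (s.image f).card = (s.image g).card :=
  (Finset.card_image_eq_card_image_mk h s).trans (Finset.card_image_eq_card_image_mk rfl s).symm

theorem Composition.card_index_eq {m : ℕ} (α : Composition m) (i : Fin α.length) :
    Nat.card {a // α.index a = i} = α.blocksFun i := by
  rw [← Nat.card_fin (α.blocksFun i)]
  refine Nat.card_congr (Equiv.ofBijective
    (fun t => (⟨α.embedding i t, α.index_embedding i t⟩ : {a // α.index a = i})) ⟨?_, ?_⟩).symm
  · intro s t h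
    simpa [Subtype.ext_iff] using h
  · rintro ⟨a, rfl⟩
    exact ⟨α.invEmbedding a, by simp⟩

theorem Composition.ker_index_injective (m : ℕ) :
    Function.Injective fun α : Composition m => Setoid.ker α.index := by
  intro α β h
  have hidx (a : Fin m) : (α.index a : ℕ) = β.index a := by
    have := Finset.card_image_eq_of_ker_eq h (Finset.Iic a)
    simpa [Composition.card_image_index_Iic] using this
  have hlen : α.length = β.length := by
    have := Finset.card_image_eq_of_ker_eq h Finset.univ
    simpa [Finset.image_univ_of_surjective, Composition.index_surjective] using this
  refine Composition.ext (List.ext_getElem hlen fun i h₁ h₂ => ?_)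
  have e₁ := α.card_index_eq ⟨i, h₁⟩
  have e₂ := β.card_index_eq ⟨i, h₂⟩
  refine e₁.symm.trans (Eq.trans ?_ e₂)
  simp_rw [Fin.ext_iff, hidx]

/-! ### Inversion over a finite semilattice -/

/-- The meet matrix of `A ↦ ∑_{C ≤ A} N C` has linearly independent columns. -/
theorem eq_zero_of_forall_sum_inf_eq_zero {T ι K : Type*} [SemilatticeInf T] [Fintype T]
    [Fintype ι] [Field K] {I : ι → T} (hI : Function.Injective I) {N : T → K} (hN : ∀ C, N C ≠ 0)
    {c : ι → K} (h : ∀ A, ∑ i, c i * ∑ C with C ≤ A ⊓ I i, N C = 0) (i : ι) : c i = 0 := by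
  have hsum (A : T) : ∑ C with C ≤ A, N C * ∑ i with C ≤ I i, c i = 0 := by
    rw [← h A]
    simp_rw [le_inf_iff, Finset.sum_filter, ite_and, Finset.mul_sum, mul_ite, mul_zero]
    rw [Finset.sum_comm]
    refine Finset.sum_congr rfl fun C _ => ?_
    split_ifs <;> simp [mul_comm]
  have hD (A : T) : N A * ∑ i with A ≤ I i, c i = 0 := by
    induction A using WellFoundedLT.induction with
    | ind A ih =>
      rw [← hsum A, eq_comm]
      refine Finset.sum_eq_single_of_mem A (by simp) fun C hC hne => ?_
      exact ih C (lt_of_le_of_ne (Finset.mem_filter.1 hC).2 hne)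
  have hG (A : T) : ∑ i with A ≤ I i, c i = 0 := (mul_eq_zero.1 (hD A)).resolve_left (hN A)
  have key (A : T) : ∀ i, I i = A → c i = 0 := by
    induction A using WellFoundedGT.induction with
    | ind A ih =>
      rintro i rfl
      rw [← hG (I i)]
      refine (Finset.sum_eq_single_of_mem i (by simp) fun k hk hne => ?_).symm
      exact ih _ (lt_of_le_of_ne (by simpa using hk) fun e => hne (hI e.symm)) k rfl
  exact key _ i rfl

theorem Setoid.exists_ker_eq {m n : ℕ} (hmn : m ≤ n) (A : Setoid (Fin m)) :
    ∃ w : Fin m → Fin n, Setoid.ker w = A := by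
  refine ⟨fun a => Fin.castLE hmn (Quotient.mk A a).out, Setoid.ext fun a b => ?_⟩
  rw [Setoid.ker_def, (Fin.castLE_injective hmn).eq_iff, Quotient.out_inj, Quotient.eq]

/-- The family `(H_α)`, indexed by all compositions `α` of `m`, is linearly independent
over ℚ in `F_n`, for `m ≥ 1` and `n ≥ m`. -/
theorem stmt5 (m n : ℕ) (hm : 1 ≤ m) (hmn : m ≤ n) :
    LinearIndependent ℚ (fun α : Composition m => Hcomp n α) := by
  have := Fintype.ofFinite (Setoid (Fin m))
  rw [Fintype.linearIndependent_iff]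
  intro c hc α
  have hfact (β : Composition m) : (∏ j, ((β.blocksFun j).factorial : ℚ)) ≠ 0 :=
    Finset.prod_ne_zero_iff.2 fun j _ => by positivity
  have hcoeff (w : Fin m → Fin n) :
      ∑ β : Composition m, c β * ∏ j, ((lamFact (Setoid.ker (w ∘ β.embedding j)) : ℚ) /
        (β.blocksFun j).factorial) = 0 := by
    refine Fintype.linearIndependent_iff.1 (linearIndependent_word n m)
      (fun w => ∑ β : Composition m, c β * ∏ j, ((lamFact (Setoid.ker (w ∘ β.embedding j)) : ℚ) /
        (β.blocksFun j).factorial)) ?_ w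
    rw [← hc]
    simp_rw [Hcomp_eq_sum_word, Finset.smul_sum, Finset.sum_smul, smul_smul]
    exact Finset.sum_comm
  have key := eq_zero_of_forall_sum_inf_eq_zero (K := ℚ) (Composition.ker_index_injective m)
    (N := fun C => (orbitCount C : ℚ)) (fun C => Nat.cast_ne_zero.2 (orbitCount_ne_zero C))
    (c := fun β => c β / ∏ j, ((β.blocksFun j).factorial : ℚ)) (fun A => ?_) α
  · exact (div_eq_zero_iff.1 key).resolve_right (hfact α)
  · obtain ⟨w, rfl⟩ := Setoid.exists_ker_eq hmn A
    rw [← hcoeff w]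
    refine Finset.sum_congr rfl fun β _ => ?_
    rw [Finset.prod_div_distrib, ← Nat.cast_prod (fun j => lamFact _) Finset.univ,
      prod_lamFact_ker_comp_embedding, lamFact_eq_sum_orbitCount, Nat.cast_sum]
    ring
end

section
/- Let n ≥ 1. The determinant of the square matrix indexed by pairs of compositions of n whose (α, β) entry is (α∪β)! equals ∏_{α composition of n} ∏_{i=1}^{ℓ(α)} G(α_i), where G(k) is the number of permutations of Fin k with no global descent. -/
open scoped Classical

noncomputable section

/-- The descent set of a composition of `n`, as a `Finset (Fin (n-1))`. -/
def descents {n : ℕ} (α : Composition n) : Finset (Fin (n - 1)) :=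
  compositionAsSetEquiv n (compositionEquiv n α)

/-- `α ∪ β`: the unique composition of `n` whose descent set is `D(α) ∪ D(β)`. -/
def cup {n : ℕ} (α β : Composition n) : Composition n :=
  (compositionEquiv n).symm ((compositionAsSetEquiv n).symm (descents α ∪ descents β))

/-- `α! = α_1! α_2! ⋯ α_{ℓ(α)}!`. -/
def compFact {n : ℕ} (α : Composition n) : ℕ :=
  (α.blocks.map Nat.factorial).prod

/-- A permutation `π` of `Fin k` has a global descent at position `j` (`1 ≤ j ≤ k−1`)
if `π a > π b` whenever `a < j ≤ b`. -/
def HasGlobalDescent {k : ℕ} (π : Equiv.Perm (Fin k)) : Prop :=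
  ∃ j : ℕ, 1 ≤ j ∧ j ≤ k - 1 ∧ ∀ a b : Fin k, (a : ℕ) < j → j ≤ (b : ℕ) → π b < π a

/-- `G k`: the number of permutations of `Fin k` with no global descent. -/
def G (k : ℕ) : ℕ := Nat.card {π : Equiv.Perm (Fin k) // ¬ HasGlobalDescent π}

end

/-- `π` has a global descent at `j`, with no condition on the range of `j`; in particular this
holds trivially for `j = 0` and for `k ≤ j`. -/
def IsGlobalDescentAt {k : ℕ} (π : Equiv.Perm (Fin k)) (j : ℕ) : Prop :=
  ∀ a b : Fin k, (a : ℕ) < j → j ≤ (b : ℕ) → π b < π a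

lemma isGlobalDescentAt_zero {k : ℕ} (π : Equiv.Perm (Fin k)) : IsGlobalDescentAt π 0 :=
  fun _ _ ha => absurd ha (Nat.not_lt_zero _)

lemma isGlobalDescentAt_of_le {k j : ℕ} (π : Equiv.Perm (Fin k)) (h : k ≤ j) :
    IsGlobalDescentAt π j :=
  fun _ b _ hb => absurd b.isLt (by omega)

lemma not_hasGlobalDescent_iff {k : ℕ} (π : Equiv.Perm (Fin k)) :
    ¬ HasGlobalDescent π ↔ ∀ j, 1 ≤ j → j < k → ¬ IsGlobalDescentAt π j := by
  simp only [HasGlobalDescent, IsGlobalDescentAt, not_exists, not_and]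
  constructor
  · intro h j h1 h2
    exact h j h1 (by omega)
  · intro h j h1 h2
    rcases Nat.lt_or_ge j k with h3 | h3
    · exact h j h1 h3
    · omega

/-- The skew sum of two permutations: all values on the first block exceed those on the second. -/
def skewSum {m k : ℕ} (p : Equiv.Perm (Fin m) × Equiv.Perm (Fin k)) : Equiv.Perm (Fin (m + k)) :=
  finSumFinEquiv.symm.trans ((Equiv.sumCongr p.1 p.2).trans
    ((Equiv.sumComm _ _).trans (finSumFinEquiv.trans (finCongr (Nat.add_comm k m)))))

lemma skewSum_castAdd {m k : ℕ} (p : Equiv.Perm (Fin m) × Equiv.Perm (Fin k)) (a : Fin m) :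
    (skewSum p (Fin.castAdd k a) : ℕ) = k + p.1 a := by
  simp [skewSum, Nat.add_comm]

lemma skewSum_natAdd {m k : ℕ} (p : Equiv.Perm (Fin m) × Equiv.Perm (Fin k)) (b : Fin k) :
    (skewSum p (Fin.natAdd m b) : ℕ) = p.2 b := by
  simp [skewSum]

lemma skewSum_injective {m k : ℕ} :
    Function.Injective (skewSum : Equiv.Perm (Fin m) × Equiv.Perm (Fin k) → _) := by
  rintro p q h
  ext a
  · have := skewSum_castAdd p a
    rw [h, skewSum_castAdd] at this
    omega
  · have := skewSum_natAdd p a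
    rw [h, skewSum_natAdd] at this
    omega

lemma isGlobalDescentAt_skewSum_of_le {m k j : ℕ} (p : Equiv.Perm (Fin m) × Equiv.Perm (Fin k))
    (hj : j ≤ m) : IsGlobalDescentAt (skewSum p) j ↔ IsGlobalDescentAt p.1 j := by
  simp only [IsGlobalDescentAt, Fin.forall_fin_add, Fin.lt_def, skewSum_castAdd, skewSum_natAdd,
    Fin.val_castAdd, Fin.val_natAdd]
  constructor
  · intro h a b ha hb
    have := (h.1 a).1 b ha hb
    omega
  · intro h
    refine ⟨fun a => ⟨fun b ha hb => ?_, fun b ha hb => ?_⟩, fun a => ⟨fun b ha hb => ?_, ?_⟩⟩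
    · have := h a b ha hb
      omega
    · omega
    · omega
    · intro b ha; omega

lemma isGlobalDescentAt_skewSum_add {m k j : ℕ} (p : Equiv.Perm (Fin m) × Equiv.Perm (Fin k)) :
    IsGlobalDescentAt (skewSum p) (m + j) ↔ IsGlobalDescentAt p.2 j := by
  simp only [IsGlobalDescentAt, Fin.forall_fin_add, Fin.lt_def, skewSum_castAdd, skewSum_natAdd,
    Fin.val_castAdd, Fin.val_natAdd]
  constructor
  · intro h a b ha hb
    exact (h.2 a).2 b (by omega) (by omega)
  · intro h
    refine ⟨fun a => ⟨fun b ha hb => ?_, fun b ha hb => ?_⟩, fun a => ⟨fun b ha hb => ?_, ?_⟩⟩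
    · omega
    · omega
    · omega
    · intro b ha hb; exact h a b (by omega) (by omega)

lemma le_of_isGlobalDescentAt {m k : ℕ} {π : Equiv.Perm (Fin (m + k))}
    (h : IsGlobalDescentAt π m) (a : Fin m) : k ≤ (π (Fin.castAdd k a) : ℕ) := by
  have hsub : Finset.univ.map ((Fin.natAddEmb m).trans π.toEmbedding)
      ⊆ Finset.Iio (π (Fin.castAdd k a)) := by
    intro x hx
    obtain ⟨b, -, rfl⟩ := Finset.mem_map.1 hx
    exact Finset.mem_Iio.2 (h _ _ (by simp) (by simp))
  simpa using Finset.card_le_card hsub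

lemma exists_skewSum_eq {m k : ℕ} {π : Equiv.Perm (Fin (m + k))} (h : IsGlobalDescentAt π m) :
    ∃ p, skewSum p = π := by
  set e' : Fin m ⊕ Fin k ≃ Fin (m + k) :=
    (Equiv.sumComm _ _).trans (finSumFinEquiv.trans (finCongr (Nat.add_comm k m))) with he'
  set σ : Equiv.Perm (Fin m ⊕ Fin k) := finSumFinEquiv.trans (π.trans e'.symm) with hσ
  have hmaps : Set.MapsTo σ (Set.range Sum.inl) (Set.range Sum.inl) := by
    rintro _ ⟨a, rfl⟩
    rcases hx : σ (Sum.inl a) with c | c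
    · exact ⟨c, rfl⟩
    · exfalso
      have h1 : π (Fin.castAdd k a) = e' (Sum.inr c) := by
        rw [← hx]; simp [hσ]
      have h2 := le_of_isGlobalDescentAt h a
      rw [h1] at h2
      simp [he'] at h2
      omega
  obtain ⟨p, hp⟩ := Equiv.Perm.mem_sumCongrHom_range_of_perm_mapsTo_inl hmaps
  refine ⟨p, ?_⟩
  change Equiv.sumCongr p.1 p.2 = σ at hp
  change finSumFinEquiv.symm.trans ((Equiv.sumCongr p.1 p.2).trans e') = π
  rw [hp, hσ]
  ext x
  simp

/-- Counting permutations with a global descent at `m` through their two skew summands. -/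
lemma card_eq_mul_of_skewSum {m k : ℕ} {C : Equiv.Perm (Fin (m + k)) → Prop}
    {C₁ : Equiv.Perm (Fin m) → Prop} {C₂ : Equiv.Perm (Fin k) → Prop}
    (hC : ∀ π, C π → IsGlobalDescentAt π m) (h : ∀ p, C (skewSum p) ↔ C₁ p.1 ∧ C₂ p.2) :
    Nat.card {π // C π} = Nat.card {π // C₁ π} * Nat.card {π // C₂ π} := by
  rw [← Nat.card_prod]
  symm
  refine Nat.card_congr (Equiv.ofBijective
    (fun q => ⟨skewSum (q.1.1, q.2.1), (h _).2 ⟨q.1.2, q.2.2⟩⟩) ⟨?_, ?_⟩)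
  · rintro ⟨⟨a, ha⟩, ⟨b, hb⟩⟩ ⟨⟨c, hc⟩, ⟨d, hd⟩⟩ hq
    have := skewSum_injective (Subtype.ext_iff.1 hq)
    simp only [Prod.mk.injEq] at this
    obtain ⟨rfl, rfl⟩ := this
    rfl
  · rintro ⟨π, hπ⟩
    obtain ⟨p, rfl⟩ := exists_skewSum_eq (hC π hπ)
    have := (h p).1 hπ
    exact ⟨(⟨p.1, this.1⟩, ⟨p.2, this.2⟩), rfl⟩

/-- `j` is a partial sum of the list `l`, the empty and the full sum included. -/
def IsPartialSum (l : List ℕ) (j : ℕ) : Prop := ∃ i ≤ l.length, (l.take i).sum = j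

lemma isPartialSum_nil (j : ℕ) : IsPartialSum [] j ↔ j = 0 := by
  simp [IsPartialSum, eq_comm]

lemma isPartialSum_zero (l : List ℕ) : IsPartialSum l 0 := ⟨0, by simp⟩

lemma isPartialSum_sum (l : List ℕ) : IsPartialSum l l.sum := ⟨l.length, by simp⟩

lemma isPartialSum_cons (b : ℕ) (l : List ℕ) (j : ℕ) :
    IsPartialSum (b :: l) j ↔ j = 0 ∨ ∃ j', IsPartialSum l j' ∧ j = b + j' := by
  constructor
  · rintro ⟨_ | i, hi, rfl⟩
    · simp
    · exact Or.inr ⟨_, ⟨i, by simpa using hi, rfl⟩, by simp⟩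
  · rintro (rfl | ⟨_, ⟨i, hi, rfl⟩, rfl⟩)
    · exact isPartialSum_zero _
    · exact ⟨i + 1, by simpa using hi, by simp⟩

lemma card_forall_isGlobalDescentAt (l : List ℕ) :
    Nat.card {π : Equiv.Perm (Fin l.sum) // ∀ j, IsPartialSum l j → IsGlobalDescentAt π j} =
      (l.map Nat.factorial).prod := by
  induction l with
  | nil =>
    rw [List.map_nil, List.prod_nil, Nat.card_eq_one_iff_unique]
    have : IsEmpty (Fin ([] : List ℕ).sum) := Fin.isEmpty
    exact ⟨inferInstance, ⟨1, fun j _ => isGlobalDescentAt_of_le _ (by simp)⟩⟩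
  | cons b l ih =>
    have key := card_eq_mul_of_skewSum (m := b) (k := l.sum)
      (C := fun π => ∀ j, IsPartialSum (b :: l) j → IsGlobalDescentAt π j)
      (C₁ := fun _ => True) (C₂ := fun π => ∀ j, IsPartialSum l j → IsGlobalDescentAt π j)
      (fun π h => h b ((isPartialSum_cons _ _ _).2 (Or.inr ⟨0, isPartialSum_zero _, rfl⟩)))
      (fun p => by
        simp only [isPartialSum_cons, true_and]
        constructor
        · intro h j hj
          exact (isGlobalDescentAt_skewSum_add p).1 (h _ (Or.inr ⟨j, hj, rfl⟩))
        · rintro h _ (rfl | ⟨j, hj, rfl⟩)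
          · exact isGlobalDescentAt_zero _
          · exact (isGlobalDescentAt_skewSum_add p).2 (h j hj))
    rw [ih] at key
    refine Eq.trans key ?_
    simp [Nat.card_eq_fintype_card, Fintype.card_perm]

lemma card_forall_isGlobalDescentAt_iff (l : List ℕ) (hl : ∀ b ∈ l, 0 < b) :
    Nat.card {π : Equiv.Perm (Fin l.sum) //
      ∀ j ≤ l.sum, IsGlobalDescentAt π j ↔ IsPartialSum l j} = (l.map G).prod := by
  induction l with
  | nil =>
    rw [List.map_nil, List.prod_nil, Nat.card_eq_one_iff_unique]
    have : IsEmpty (Fin ([] : List ℕ).sum) := Fin.isEmpty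
    exact ⟨inferInstance, ⟨1, fun j hj => iff_of_true (isGlobalDescentAt_of_le _ (by simp))
      ((isPartialSum_nil j).2 (by simpa using hj))⟩⟩
  | cons b l ih =>
    have hb : 0 < b := hl b (by simp)
    have key := card_eq_mul_of_skewSum (m := b) (k := l.sum)
      (C := fun π => ∀ j ≤ b + l.sum, IsGlobalDescentAt π j ↔ IsPartialSum (b :: l) j)
      (C₁ := fun π => ¬ HasGlobalDescent π)
      (C₂ := fun π => ∀ j ≤ l.sum, IsGlobalDescentAt π j ↔ IsPartialSum l j)
      (fun π h => (h b (by omega)).2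
        ((isPartialSum_cons _ _ _).2 (Or.inr ⟨0, isPartialSum_zero _, rfl⟩)))
      (fun p => by
        simp only [isPartialSum_cons, not_hasGlobalDescent_iff]
        constructor
        · intro h
          refine ⟨fun j h1 h2 hj => ?_, fun j hj => ?_⟩
          · rw [← isGlobalDescentAt_skewSum_of_le p h2.le, h j (by omega)] at hj
            rcases hj with rfl | ⟨j', -, rfl⟩ <;> omega
          · rw [← isGlobalDescentAt_skewSum_add p, h _ (by omega)]
            constructor
            · rintro (h0 | ⟨j', hj', h0⟩)
              · omega
              · obtain rfl : j = j' := by omega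
                exact hj'
            · exact fun hj => Or.inr ⟨j, hj, rfl⟩
        · rintro ⟨h₁, h₂⟩ j hj
          rcases Nat.eq_zero_or_pos j with rfl | hpos
          · simp [isGlobalDescentAt_zero]
          rcases Nat.lt_or_ge j b with hlt | hge
          · rw [isGlobalDescentAt_skewSum_of_le p hlt.le]
            refine iff_of_false (h₁ j hpos hlt) ?_
            rintro (h0 | ⟨j', -, h0⟩) <;> omega
          · obtain ⟨i, rfl⟩ := Nat.exists_eq_add_of_le hge
            rw [isGlobalDescentAt_skewSum_add, h₂ i (by omega)]
            constructor
            · exact fun hi => Or.inr ⟨i, hi, rfl⟩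
            · rintro (h0 | ⟨j', hj', h0⟩)
              · omega
              · obtain rfl : i = j' := by omega
                exact hj')
    rw [ih fun c hc => hl c (by simp [hc])] at key
    exact key

/-- The set of global descents of a permutation, shifted as in `descents`. -/
noncomputable def globalDescents {n : ℕ} (π : Equiv.Perm (Fin n)) : Finset (Fin (n - 1)) :=
  {i | IsGlobalDescentAt π (i + 1)}

lemma mem_descents_iff {n : ℕ} (α : Composition n) (i : Fin (n - 1)) :
    i ∈ descents α ↔ IsPartialSum α.blocks (i + 1) := by
  simp only [descents, compositionAsSetEquiv, compositionEquiv, Equiv.coe_fn_mk,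
    Composition.toCompositionAsSet_boundaries, Finset.mem_univ, true_and,
    Composition.boundaries, Finset.mem_map, IsPartialSum, Set.mem_toFinset, Set.mem_ofPred_eq]
  constructor
  · rintro ⟨j, hj⟩
    refine ⟨j, by have := j.isLt; simp only [Composition.blocks_length]; omega, ?_⟩
    have := congrArg Fin.val hj
    simp [Composition.boundary, Composition.sizeUpTo] at this
    omega
  · rintro ⟨j, hj, h⟩
    refine ⟨⟨j, by rw [Composition.blocks_length] at hj; omega⟩, ?_⟩
    ext
    simp [Composition.boundary, Composition.sizeUpTo, h]
    omega

lemma forall_isGlobalDescentAt_iff_subset {n : ℕ} (α : Composition n) (π : Equiv.Perm (Fin n)) :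
    (∀ j, IsPartialSum α.blocks j → IsGlobalDescentAt π j) ↔ descents α ⊆ globalDescents π := by
  simp only [Finset.subset_iff, mem_descents_iff, globalDescents, Finset.mem_filter,
    Finset.mem_univ, true_and]
  constructor
  · exact fun h i hi => h _ hi
  · intro h j hj
    rcases Nat.eq_zero_or_pos j with rfl | hpos
    · exact isGlobalDescentAt_zero π
    rcases Nat.lt_or_ge j n with hlt | hge
    · have := @h ⟨j - 1, by omega⟩
      simp only [Nat.sub_add_cancel hpos] at this
      exact this hj
    · exact isGlobalDescentAt_of_le π hge

lemma forall_isGlobalDescentAt_iff_iff_eq {n : ℕ} (α : Composition n)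
    (π : Equiv.Perm (Fin n)) :
    (∀ j ≤ n, IsGlobalDescentAt π j ↔ IsPartialSum α.blocks j) ↔
      globalDescents π = descents α := by
  simp only [Finset.ext_iff, mem_descents_iff, globalDescents, Finset.mem_filter,
    Finset.mem_univ, true_and]
  constructor
  · exact fun h i => h _ (by omega)
  · intro h j hj
    rcases Nat.eq_zero_or_pos j with rfl | hpos
    · exact iff_of_true (isGlobalDescentAt_zero π) (isPartialSum_zero _)
    rcases Nat.lt_or_ge j n with hlt | hge
    · have := h ⟨j - 1, by omega⟩
      simpa only [Nat.sub_add_cancel hpos] using this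
    · obtain rfl : j = n := by omega
      refine iff_of_true (isGlobalDescentAt_of_le π le_rfl) ?_
      have := isPartialSum_sum α.blocks
      rwa [α.blocks_sum] at this

lemma card_descents_subset_globalDescents {n : ℕ} (α : Composition n) :
    Nat.card {π : Equiv.Perm (Fin n) // descents α ⊆ globalDescents π} = compFact α := by
  simp only [← forall_isGlobalDescentAt_iff_subset]
  have h := card_forall_isGlobalDescentAt α.blocks
  rwa [α.blocks_sum] at h

lemma card_globalDescents_eq_descents {n : ℕ} (α : Composition n) :
    Nat.card {π : Equiv.Perm (Fin n) // globalDescents π = descents α} =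
      ∏ i : Fin α.length, G (α.blocksFun i) := by
  simp only [← forall_isGlobalDescentAt_iff_iff_eq]
  have h := card_forall_isGlobalDescentAt_iff α.blocks fun b hb => α.blocks_pos hb
  rw [α.blocks_sum] at h
  rw [h, ← α.ofFn_blocksFun, List.map_ofFn, List.prod_ofFn]
  rfl

lemma descents_injective (n : ℕ) : Function.Injective (descents (n := n)) :=
  ((compositionEquiv n).trans (compositionAsSetEquiv n)).injective

lemma descents_surjective (n : ℕ) : Function.Surjective (descents (n := n)) :=
  ((compositionEquiv n).trans (compositionAsSetEquiv n)).surjective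

lemma descents_cup {n : ℕ} (α β : Composition n) :
    descents (cup α β) = descents α ∪ descents β := by
  simp [descents, cup]

/-- The incidence matrix of an injective family of finite sets is unitriangular. -/
lemma det_of_subset_eq_one {ι σ : Type*} [Fintype ι] [DecidableEq ι] {D : ι → Finset σ}
    [∀ a b, Decidable (D a ⊆ D b)] (hD : Function.Injective D) :
    (Matrix.of fun a b : ι => if D a ⊆ D b then (1 : ℚ) else 0).det = 1 := by
  have hT : (Matrix.of fun a b : ι => if D a ⊆ D b then (1 : ℚ) else 0).BlockTriangular
      fun a => (D a).card := by
    intro a b hab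
    exact if_neg fun hs => absurd (Finset.card_le_card hs) (by simpa using hab)
  rw [hT.det]
  refine Finset.prod_eq_one fun k _ => ?_
  convert Matrix.det_one (n := {a // (D a).card = k}) (R := ℚ)
  ext ⟨a, ha⟩ ⟨b, hb⟩
  simp only [Matrix.toSquareBlock_def, Matrix.of_apply, Matrix.one_apply, Subtype.mk.injEq]
  refine if_congr ⟨fun hs => hD (Finset.eq_of_subset_of_card_le hs (by omega)), ?_⟩ rfl rfl
  rintro rfl
  exact subset_rfl

lemma natCard_subtype_eq_sum {ι : Type*} [Fintype ι] (P : ι → Prop) :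
    (Nat.card {x // P x} : ℚ) = ∑ x, if P x then 1 else 0 := by
  rw [Nat.card_eq_fintype_card, Fintype.card_subtype, Finset.sum_boole]

lemma compFact_cup_eq_sum {n : ℕ} (α β : Composition n) :
    (compFact (cup α β) : ℚ) = ∑ γ : Composition n,
      (if descents α ⊆ descents γ then 1 else 0) * (∏ i : Fin γ.length, (G (γ.blocksFun i) : ℚ)) *
        (if descents β ⊆ descents γ then 1 else 0) := by
  simp only [← Nat.cast_prod, ← card_globalDescents_eq_descents]
  rw [← card_descents_subset_globalDescents, natCard_subtype_eq_sum]
  simp only [natCard_subtype_eq_sum, Finset.mul_sum, Finset.sum_mul]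
  rw [Finset.sum_comm]
  refine Finset.sum_congr rfl fun π _ => ?_
  obtain ⟨γ, hγ⟩ := descents_surjective n (globalDescents π)
  rw [Finset.sum_eq_single γ]
  · rw [descents_cup, Finset.union_subset_iff, ← hγ]
    by_cases h₁ : descents α ⊆ descents γ <;> by_cases h₂ : descents β ⊆ descents γ <;>
      simp [h₁, h₂]
  · intro δ _ hδ
    rw [← hγ, if_neg (show ¬ descents γ = descents δ from fun h => hδ (descents_injective n h.symm))]
    simp
  · simp

/-- The determinant of the matrix `[(α∪β)!]` indexed by compositions of `n` equals
`∏_{α ⊨ n} ∏_i G(α_i)`. -/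
theorem stmt6 (n : ℕ) (hn : 1 ≤ n) :
    (Matrix.of fun α β : Composition n => (compFact (cup α β) : ℚ)).det =
      ∏ α : Composition n, ∏ i : Fin α.length, (G (α.blocksFun i) : ℚ) := by
  set Z : Matrix (Composition n) (Composition n) ℚ :=
    Matrix.of fun α γ => if descents α ⊆ descents γ then 1 else 0 with hZ
  have hM : (Matrix.of fun α β : Composition n => (compFact (cup α β) : ℚ)) =
      Z * Matrix.diagonal (fun γ => ∏ i : Fin γ.length, (G (γ.blocksFun i) : ℚ)) *
        Z.transpose := by
    ext α β
    simp only [Matrix.of_apply, compFact_cup_eq_sum]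
    rw [Matrix.mul_apply]
    simp only [Matrix.mul_diagonal, Matrix.transpose_apply, hZ, Matrix.of_apply]
  rw [hM, Matrix.det_mul, Matrix.det_mul, Matrix.det_transpose, Matrix.det_diagonal, hZ,
    det_of_subset_eq_one (descents_injective n), one_mul, mul_one]
end

section
/- Let n ≥ 1, and let α be a composition of p ≥ 1 and β a composition of q ≥ 1. In F_n define M_α := ∑_g ∏_{j=1}^{ℓ(α)} x_{g(j)}^{α_j} (ordered product), where the sum runs over all functions g : {1,…,ℓ(α)} → Fin n with g(j) ≠ g(j+1) for all 1 ≤ j ≤ ℓ(α)−1. Then M_α · M_β = M_{α▷β} + M_{α·β}, where α·β is the concatenation (α_1,…,α_{ℓ(α)}, β_1,…,β_{ℓ(β)}) and α▷β := (α_1,…,α_{ℓ(α)−1}, α_{ℓ(α)}+β_1, β_2,…,β_{ℓ(β)}). -/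
open scoped Classical

/-- For a composition given as a list `L = (L_1, …, L_ℓ)` of positive integers,
`M_L := ∑_g x_{g 1}^{L_1} ⋯ x_{g ℓ}^{L_ℓ}`, the sum over all `g : Fin ℓ → Fin n`
with `g j ≠ g (j+1)` for all adjacent indices. -/
noncomputable def Mrib (n : ℕ) (L : List ℕ) : FreeAlgebra ℚ (Fin n) :=
  ∑ g : Fin L.length → Fin n,
    if ∀ (j : ℕ) (h : j + 1 < L.length), g ⟨j, Nat.lt_of_succ_lt h⟩ ≠ g ⟨j + 1, h⟩ then
      (List.ofFn fun j : Fin L.length => FreeAlgebra.ι ℚ (g j) ^ L.get j).prod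
    else 0

/-- The chain sum `Mrib` restricted to those `g` whose first letter satisfies `Q`. -/
noncomputable def MribFirst (n : ℕ) (Q : Fin n → Prop) (L : List ℕ) : FreeAlgebra ℚ (Fin n) :=
  ∑ g : Fin L.length → Fin n,
    if (∀ h : 0 < L.length, Q (g ⟨0, h⟩)) ∧
      ∀ (j : ℕ) (h : j + 1 < L.length), g ⟨j, Nat.lt_of_succ_lt h⟩ ≠ g ⟨j + 1, h⟩ then
      (List.ofFn fun j : Fin L.length => FreeAlgebra.ι ℚ (g j) ^ L.get j).prod
    else 0

theorem Mrib_eq_MribFirst (n : ℕ) (L : List ℕ) : Mrib n L = MribFirst n (fun _ => True) L := by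
  simp [Mrib, MribFirst]

theorem MribFirst_nil (n : ℕ) (Q : Fin n → Prop) : MribFirst n Q [] = 1 := by
  simp [MribFirst]

theorem MribFirst_cons (n : ℕ) (Q : Fin n → Prop) (a : ℕ) (L : List ℕ) :
    MribFirst n Q (a :: L) =
      ∑ k, if Q k then FreeAlgebra.ι ℚ k ^ a * MribFirst n (fun m => m ≠ k) L else 0 := by
  unfold MribFirst
  refine ((Fin.consEquiv fun _ : Fin (L.length + 1) => Fin n).sum_comp _).symm.trans ?_
  rw [Fintype.sum_prod_type]
  refine Finset.sum_congr rfl fun k _ => ?_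
  have chain_cons (g : Fin L.length → Fin n) :
      ((∀ h : 0 < (a :: L).length, Q ((Fin.cons k g : Fin (L.length + 1) → Fin n) ⟨0, h⟩)) ∧
        ∀ (j : ℕ) (h : j + 1 < (a :: L).length),
          (Fin.cons k g : Fin (L.length + 1) → Fin n) ⟨j, Nat.lt_of_succ_lt h⟩ ≠
            (Fin.cons k g : Fin (L.length + 1) → Fin n) ⟨j + 1, h⟩) ↔
      Q k ∧ (∀ h : 0 < L.length, g ⟨0, h⟩ ≠ k) ∧
        ∀ (j : ℕ) (h : j + 1 < L.length), g ⟨j, Nat.lt_of_succ_lt h⟩ ≠ g ⟨j + 1, h⟩ := by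
    refine and_congr ⟨fun h => h (Nat.succ_pos _), fun h _ => h⟩
      ⟨fun h => ⟨fun h0 => (h 0 (Nat.succ_lt_succ h0)).symm,
        fun j hj => h (j + 1) (Nat.succ_lt_succ hj)⟩, fun h j hj => ?_⟩
    cases j with
    | zero => exact (h.1 (Nat.lt_of_succ_lt_succ hj)).symm
    | succ j => exact h.2 j (Nat.lt_of_succ_lt_succ hj)
  have prod_cons (g : Fin L.length → Fin n) :
      (List.ofFn fun j : Fin (a :: L).length =>
        FreeAlgebra.ι ℚ ((Fin.cons k g : Fin (L.length + 1) → Fin n) j) ^ (a :: L).get j).prod =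
      FreeAlgebra.ι ℚ k ^ a *
        (List.ofFn fun j : Fin L.length => FreeAlgebra.ι ℚ (g j) ^ L.get j).prod := by
    change (List.ofFn (n := L.length + 1) _).prod = _
    rw [List.ofFn_succ, List.prod_cons]
    rfl
  by_cases hQ : Q k
  · rw [if_pos hQ, Finset.mul_sum]
    refine Finset.sum_congr rfl fun g _ => ?_
    have chain_iff := (chain_cons g).trans (and_iff_right hQ)
    rw [mul_ite, mul_zero, ← prod_cons]
    split_ifs with h₁ h₂ h₂
    · rfl
    · exact absurd (chain_iff.1 h₁) h₂
    · exact absurd (chain_iff.2 h₂) h₁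
    · rfl
  · rw [if_neg hQ]
    exact Finset.sum_eq_zero fun g _ => if_neg fun h => hQ ((chain_cons g).1 h).1

theorem MribFirst_mul (n : ℕ) (Q : Fin n → Prop) (α β : List ℕ) (hα : α ≠ []) (hβ : β ≠ []) :
    MribFirst n Q α * MribFirst n (fun _ => True) β =
      MribFirst n Q (α.dropLast ++ (α.getLast hα + β.head hβ) :: β.tail) +
        MribFirst n Q (α ++ β) := by
  induction α generalizing Q with
  | nil => exact absurd rfl hα
  | cons a α ih =>
    rcases α with _ | ⟨a', α⟩
    · obtain ⟨b, β, rfl⟩ := List.exists_cons_of_ne_nil hβ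
      simp only [List.dropLast_singleton, List.getLast_singleton, List.head_cons, List.tail_cons,
        List.nil_append, List.cons_append, MribFirst_cons, MribFirst_nil, mul_one, if_true]
      rw [Finset.sum_mul, ← Finset.sum_add_distrib]
      refine Finset.sum_congr rfl fun k _ => ?_
      split_ifs
      · rw [← Finset.add_sum_erase _ _ (Finset.mem_univ k), mul_add, pow_add, mul_assoc]
        simp [Finset.sum_ite, Finset.filter_ne']
      · simp
    · rw [List.dropLast_cons_of_ne_nil (List.cons_ne_nil a' α),
        List.getLast_cons (List.cons_ne_nil a' α), List.cons_append, List.cons_append,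
        MribFirst_cons, MribFirst_cons n Q a (_ ++ _), MribFirst_cons n Q a (_ ++ _),
        Finset.sum_mul, ← Finset.sum_add_distrib]
      refine Finset.sum_congr rfl fun k _ => ?_
      split_ifs
      · rw [mul_assoc, ih _ (List.cons_ne_nil a' α), mul_add]
      · simp

/-- `M_α · M_β = M_{α▷β} + M_{α·β}` where `α·β` is concatenation and
`α▷β = (α_1,…,α_{ℓ(α)−1}, α_{ℓ(α)}+β_1, β_2,…,β_{ℓ(β)})`. -/
theorem stmt9 (n p q : ℕ) (hn : 1 ≤ n) (hp : 1 ≤ p) (hq : 1 ≤ q)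
    (α β : List ℕ) (hα : α ≠ []) (hβ : β ≠ [])
    (hαpos : ∀ x ∈ α, 0 < x) (hβpos : ∀ x ∈ β, 0 < x)
    (hαsum : α.sum = p) (hβsum : β.sum = q) :
    Mrib n α * Mrib n β =
      Mrib n (α.dropLast ++ (α.getLast hα + β.head hβ) :: β.tail) +
        Mrib n (α ++ β) := by
  simpa only [Mrib_eq_MribFirst] using MribFirst_mul n _ α β hα hβ
end

section
/- Let n ≥ 1. There exist an index set J, a degree function d : J → ℕ with d(j) ≥ 1 for all j, and a family f : J → F_n such that: each f_j is S_n-invariant and homogeneous of degree d(j) (i.e., f_j ∈ V_{d(j)}); the ℚ-algebra homomorphism FreeAlgebra ℚ J → F_n sending the j-th generator to f_j is injective and its range is exactly the subalgebra NCSym_n of S_n-invariants; and for every m ≥ 1 the number of j ∈ J with d(j) = m equals w_{m,n}, where w_{m,n} is defined by the recurrence w_{m,n} = b_{m,n} − ∑_{i=1}^{m−1} w_{i,n}·b_{m−i,n}, and b_{m,n} is the number of setoids on Fin m with at most n equivalence classes. -/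
open scoped Classical

noncomputable section

/-- The S_n action on the free algebra, permuting the generators. -/
def act (n : ℕ) (σ : Equiv.Perm (Fin n)) :
    FreeAlgebra ℚ (Fin n) →ₐ[ℚ] FreeAlgebra ℚ (Fin n) :=
  FreeAlgebra.lift ℚ fun i => FreeAlgebra.ι ℚ (σ i)

/-- The subalgebra `NCSym_n` of S_n-invariant elements of `F_n`. -/
def NCSymAlg (n : ℕ) : Subalgebra ℚ (FreeAlgebra ℚ (Fin n)) where
  carrier := {f | ∀ σ : Equiv.Perm (Fin n), act n σ f = f}
  add_mem' := fun {a b} ha hb σ => by rw [map_add, ha σ, hb σ]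
  mul_mem' := fun {a b} ha hb σ => by rw [map_mul, ha σ, hb σ]
  algebraMap_mem' := fun c σ => (act n σ).commutes c

/-- The degree-`m` homogeneous component of `F_n`: the span of the words of length `m`. -/
def Vsub (n m : ℕ) : Submodule ℚ (FreeAlgebra ℚ (Fin n)) :=
  Submodule.span ℚ (Set.range (word n m))

/-- `b_{m,n}`: the number of set partitions (setoids) of `Fin m` with at most `n`
equivalence classes. -/
def bcount (m n : ℕ) : ℕ :=
  Nat.card {A : Setoid (Fin m) // Nat.card (Quotient A) ≤ n}

end

noncomputable section

namespace FreeAlgebra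

variable {X : Type*}

/-- The monomial of the free algebra attached to a word. -/
def monomial (l : List X) : FreeAlgebra ℚ X :=
  (l.map (ι ℚ)).prod

/-- The coefficient of a word in an element of the free algebra. -/
def wordCoeff (g : FreeAlgebra ℚ X) (l : List X) : ℚ :=
  (equivMonoidAlgebraFreeMonoid g).coeff (FreeMonoid.ofList l)

theorem equiv_monomial (l : List X) :
    equivMonoidAlgebraFreeMonoid (monomial l) =
      MonoidAlgebra.single (FreeMonoid.ofList l) (1 : ℚ) := by
  rw [← AlgEquiv.eq_symm_apply]
  simp [equivMonoidAlgebraFreeMonoid, monomial, FreeMonoid.lift_apply]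

theorem wordCoeff_monomial (l l' : List X) :
    wordCoeff (monomial l) l' = if l = l' then 1 else 0 := by
  rw [wordCoeff, equiv_monomial, MonoidAlgebra.coeff_single, Finsupp.single_apply]
  simp only [EmbeddingLike.apply_eq_iff_eq]

theorem wordCoeff_sum {ι' : Type*} (s : Finset ι') (g : ι' → FreeAlgebra ℚ X) (l : List X) :
    wordCoeff (∑ i ∈ s, g i) l = ∑ i ∈ s, wordCoeff (g i) l := by
  simp [wordCoeff, map_sum]

theorem wordCoeff_smul (c : ℚ) (g : FreeAlgebra ℚ X) (l : List X) :
    wordCoeff (c • g) l = c * wordCoeff g l := by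
  simp [wordCoeff]

theorem wordCoeff_sub (g h : FreeAlgebra ℚ X) (l : List X) :
    wordCoeff (g - h) l = wordCoeff g l - wordCoeff h l := by
  simp [wordCoeff]

theorem wordCoeff_one (l : List X) :
    wordCoeff (1 : FreeAlgebra ℚ X) l = if [] = l then 1 else 0 := by
  simpa [monomial] using wordCoeff_monomial [] l

theorem finite_wordCoeff_ne_zero (g : FreeAlgebra ℚ X) :
    {l | wordCoeff g l ≠ 0}.Finite :=
  (equivMonoidAlgebraFreeMonoid g).coeff.hasFiniteSupport

theorem eq_zero_of_wordCoeff {g : FreeAlgebra ℚ X} (h : ∀ l, wordCoeff g l = 0) : g = 0 := by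
  refine (map_eq_zero_iff _ equivMonoidAlgebraFreeMonoid.injective).1 ?_
  ext l
  exact h l

theorem eq_sum_wordCoeff_smul_monomial (g : FreeAlgebra ℚ X) :
    g = ∑ l ∈ (finite_wordCoeff_ne_zero g).toFinset, wordCoeff g l • monomial l := by
  refine sub_eq_zero.1 (eq_zero_of_wordCoeff fun l => ?_)
  by_cases hl : wordCoeff g l = 0 <;>
    simp [wordCoeff_sub, wordCoeff_sum, wordCoeff_smul, wordCoeff_monomial, hl]

theorem exists_append_of_wordCoeff_mul_ne_zero {g h : FreeAlgebra ℚ X} {l : List X}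
    (hl : wordCoeff (g * h) l ≠ 0) :
    ∃ u v, l = u ++ v ∧ wordCoeff g u ≠ 0 ∧ wordCoeff h v ≠ 0 := by
  rw [wordCoeff, map_mul] at hl
  have := MonoidAlgebra.support_coeff_mul_subset _ _ (Finsupp.mem_support_iff.2 hl)
  obtain ⟨u, hu, v, hv, huv⟩ := Finset.mem_mul.1 this
  exact ⟨u, v, huv.symm, Finsupp.mem_support_iff.1 hu, Finsupp.mem_support_iff.1 hv⟩

theorem wordCoeff_mul_append {g h : FreeAlgebra ℚ X} {u v : List X}
    (hg : ∀ l, wordCoeff g l ≠ 0 → l.length = u.length) :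
    wordCoeff (g * h) (u ++ v) = wordCoeff g u * wordCoeff h v := by
  rw [wordCoeff, map_mul, FreeMonoid.ofList_append]
  refine MonoidAlgebra.coeff_mul_mul_of_uniqueMul fun a b ha _ hab => ?_
  exact List.append_inj hab (hg a (Finsupp.mem_support_iff.1 ha))

theorem lift_monomial {A : Type*} [Semiring A] [Algebra ℚ A] (f : X → A) (s : List X) :
    lift ℚ f (monomial s) = (s.map f).prod := by
  simp [monomial, map_list_prod, Function.comp_def]

section Leads

variable [LinearOrder X]

/-- `g` is homogeneous and `r` is the smallest word occurring in it. -/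
def Leads (g : FreeAlgebra ℚ X) (r : List X) : Prop :=
  (∀ l, wordCoeff g l ≠ 0 → l.length = r.length ∧ r ≤ l) ∧ wordCoeff g r ≠ 0

theorem _root_.List.cons_le_cons_iff_lex {a b : X} {u v : List X} :
    a :: u ≤ b :: v ↔ a < b ∨ a = b ∧ u ≤ v := by
  rw [← not_lt, List.cons_lt_cons_iff, ← not_lt (a := v)]
  rcases lt_trichotomy a b with h | rfl | h
  · simp [h, h.not_gt, h.ne']
  · simp
  · simp [h, h.not_gt, h.ne']

theorem _root_.List.append_le_append_of_length_eq {u u' v v' : List X}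
    (h : u.length = u'.length) (hu : u ≤ u') (hv : v ≤ v') : u ++ v ≤ u' ++ v' := by
  induction u generalizing u' with
  | nil => cases u' <;> simp_all
  | cons a u ih =>
    cases u' with
    | nil => simp at h
    | cons a' u' =>
      rw [List.cons_append, List.cons_append, List.cons_le_cons_iff_lex]
      rcases List.cons_le_cons_iff_lex.1 hu with h1 | ⟨h1, h2⟩
      · exact Or.inl h1
      · exact Or.inr ⟨h1, ih (by simpa using h) h2⟩

theorem _root_.List.le_of_append_le_append_of_length_eq {u u' v v' : List X}
    (h : u.length = u'.length) (huv : u ++ v ≤ u' ++ v') : u ≤ u' := by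
  by_contra! hlt
  induction u generalizing u' with
  | nil => cases u' <;> simp_all
  | cons a u ih =>
    cases u' with
    | nil => simp at h
    | cons a' u' =>
      rw [List.cons_append, List.cons_append, List.cons_le_cons_iff_lex] at huv
      rcases List.cons_lt_cons_iff.1 hlt with h1 | ⟨h1, h2⟩
      · rcases huv with h3 | h3
        · exact lt_asymm h1 h3
        · exact h1.ne' h3.1
      · subst h1
        exact ih (by simpa using h) (by simpa using huv) h2

theorem leads_one : Leads (1 : FreeAlgebra ℚ X) [] := by
  refine ⟨fun l hl => ?_, by simp [wordCoeff_one]⟩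
  rw [wordCoeff_one] at hl
  obtain rfl : [] = l := by by_contra h; simp [h] at hl
  simp

theorem Leads.mul {g h : FreeAlgebra ℚ X} {r s : List X} (hg : Leads g r) (hh : Leads h s) :
    Leads (g * h) (r ++ s) := by
  constructor
  · intro l hl
    obtain ⟨u, v, rfl, hu, hv⟩ := exists_append_of_wordCoeff_mul_ne_zero hl
    obtain ⟨hu1, hu2⟩ := hg.1 u hu
    obtain ⟨hv1, hv2⟩ := hh.1 v hv
    exact ⟨by simp [hu1, hv1], List.append_le_append_of_length_eq hu1.symm hu2 hv2⟩
  · rw [wordCoeff_mul_append fun l hl => (hg.1 l hl).1]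
    exact mul_ne_zero hg.2 hh.2

theorem Leads.list_prod {J : Type*} {f : J → FreeAlgebra ℚ X} {r : J → List X}
    (h : ∀ j, Leads (f j) (r j)) (s : List J) : Leads (s.map f).prod (s.map r).flatten := by
  induction s with
  | nil => simpa using leads_one
  | cons j s ih => simpa using (h j).mul ih

/-- If the leading words of the `f j` generate a free monoid, the `f j` generate a free algebra. -/
theorem lift_injective_of_leads {J : Type*} {f : J → FreeAlgebra ℚ X} {r : J → List X}
    (h : ∀ j, Leads (f j) (r j))
    (hr : Function.Injective fun s : List J => (s.map r).flatten) :
    Function.Injective (lift ℚ f) := by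
  rw [injective_iff_map_eq_zero]
  intro x hx
  by_contra hx0
  set T := (finite_wordCoeff_ne_zero x).toFinset with hT
  have hne : T.Nonempty := by
    by_contra hT0
    refine hx0 (eq_zero_of_wordCoeff fun l => ?_)
    by_contra hl
    exact hT0 ⟨l, by simpa [hT] using hl⟩
  obtain ⟨s, hs, hmin⟩ := T.exists_min_image (fun s => (s.map r).flatten) hne
  have key : wordCoeff (lift ℚ f x) (s.map r).flatten =
      wordCoeff x s * wordCoeff (s.map f).prod (s.map r).flatten := by
    conv_lhs => rw [eq_sum_wordCoeff_smul_monomial x]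
    simp only [map_sum, map_smul, lift_monomial, wordCoeff_sum, wordCoeff_smul]
    refine Finset.sum_eq_single_of_mem s hs fun t ht hts => ?_
    by_contra h0
    refine hts (hr (le_antisymm ?_ (hmin t ht)))
    exact ((Leads.list_prod h t).1 _ (right_ne_zero_of_mul h0)).2
  have h2 : wordCoeff x s ≠ 0 := by simpa [hT] using hs
  rw [hx] at key
  refine mul_ne_zero h2 (Leads.list_prod h s).2 (key.symm.trans ?_)
  simp [wordCoeff]

/-- If every smallest word of an element of `A` is the leading word of an element of the subspace
`R` of `A`, then `R` is all of `A`. -/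
theorem le_of_leads [Finite X] {A R : Submodule ℚ (FreeAlgebra ℚ X)} (hRA : R ≤ A)
    (h : ∀ g ∈ A, ∀ r, wordCoeff g r ≠ 0 → (∀ l, wordCoeff g l ≠ 0 → r ≤ l) →
      ∃ p ∈ R, Leads p r) : A ≤ R := by
  intro g hg
  obtain ⟨N, hN⟩ : ∃ N, ∀ l, wordCoeff g l ≠ 0 → l.length ≤ N := by
    obtain ⟨N, hN⟩ := ((finite_wordCoeff_ne_zero g).image List.length).bddAbove
    exact ⟨N, fun l hl => hN ⟨l, hl, rfl⟩⟩
  have hW : {l : List X | l.length ≤ N}.Finite := List.finite_length_le X N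
  set W := hW.toFinset with hWdef
  have hmem : ∀ l, l ∈ W ↔ l.length ≤ N := by simp [hWdef]
  induction hk : (W.filter fun l => ∃ v, wordCoeff g v ≠ 0 ∧ v ≤ l).card using
    Nat.strong_induction_on generalizing g with
  | _ k ih =>
  by_cases hg0 : ∀ l, wordCoeff g l = 0
  · rw [eq_zero_of_wordCoeff hg0]
    exact R.zero_mem
  push Not at hg0
  obtain ⟨r, hr, hmin⟩ := Set.exists_min_image _ id (finite_wordCoeff_ne_zero g) hg0
  simp only [id] at hmin
  obtain ⟨p, hp, hpr⟩ := h g hg r hr hmin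
  set c := wordCoeff g r / wordCoeff p r
  have hsupp : ∀ l, wordCoeff (g - c • p) l ≠ 0 → r < l ∧ l.length ≤ N := by
    intro l hl
    have hlr : l ≠ r := by
      rintro rfl
      apply hl
      rw [wordCoeff_sub, wordCoeff_smul, div_mul_cancel₀ _ hpr.2, sub_self]
    by_cases hgl : wordCoeff g l = 0
    · have hpl : wordCoeff p l ≠ 0 := by
        intro h0
        exact hl (by simp [wordCoeff_sub, wordCoeff_smul, hgl, h0])
      exact ⟨lt_of_le_of_ne (hpr.1 l hpl).2 hlr.symm, (hpr.1 l hpl).1.trans_le (hN r hr)⟩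
    · exact ⟨lt_of_le_of_ne (hmin l hgl) hlr.symm, hN l hgl⟩
  have hcp := R.smul_mem c hp
  rw [← sub_add_cancel g (c • p)]
  refine R.add_mem (ih _ ?_ (A.sub_mem hg (hRA hcp)) (fun l hl => (hsupp l hl).2) rfl) hcp
  rw [← hk]
  refine Finset.card_lt_card (Finset.ssubset_iff_of_subset ?_ |>.2 ⟨r, ?_, ?_⟩)
  · intro l
    simp only [Finset.mem_filter]
    rintro ⟨hl, v, hv, hvl⟩
    exact ⟨hl, r, hr, (hsupp v hv).1.le.trans hvl⟩
  · exact Finset.mem_filter.2 ⟨(hmem r).2 (hN r hr), r, hr, le_rfl⟩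
  · simp only [Finset.mem_filter, not_and, not_exists]
    intro _ v hv hvr
    exact absurd (hsupp v hv).1 hvr.not_gt

end Leads

end FreeAlgebra

section LexMin

variable {n : ℕ}

/-- A word which is lexicographically minimal in its orbit under permutations of the letters. -/
def IsLexMin (l : List (Fin n)) : Prop :=
  ∀ σ : Equiv.Perm (Fin n), l ≤ l.map σ

theorem isLexMin_nil : IsLexMin ([] : List (Fin n)) := fun _ => by simp

theorem IsLexMin.append {u v : List (Fin n)} (hu : IsLexMin u) (hv : IsLexMin v) :
    IsLexMin (u ++ v) := fun σ => by
  rw [List.map_append]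
  exact List.append_le_append_of_length_eq (by simp) (hu σ) (hv σ)

theorem IsLexMin.of_append {u v : List (Fin n)} (h : IsLexMin (u ++ v)) : IsLexMin u := fun σ => by
  have := h σ
  rw [List.map_append] at this
  exact List.le_of_append_le_append_of_length_eq (by simp) this

/-- A nonempty lexicographically minimal word which is not a product of two such words. -/
structure IsIndecomposable (l : List (Fin n)) : Prop where
  ne_nil : l ≠ []
  isLexMin : IsLexMin l
  eq_nil_or_eq_nil : ∀ u v, l = u ++ v → IsLexMin v → u = [] ∨ v = []

theorem IsIndecomposable.append_inj {j j' v v' : List (Fin n)} (hj : IsIndecomposable j)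
    (hj' : IsIndecomposable j') (hv : IsLexMin v) (hv' : IsLexMin v') (h : j ++ v = j' ++ v') :
    j = j' ∧ v = v' := by
  rcases List.append_eq_append_iff.1 h with ⟨a, rfl, rfl⟩ | ⟨a, rfl, rfl⟩
  · obtain h | rfl := hj'.eq_nil_or_eq_nil j a rfl hv.of_append
    · exact absurd h hj.ne_nil
    · simp
  · obtain h | rfl := hj.eq_nil_or_eq_nil j' a rfl hv'.of_append
    · exact absurd h hj'.ne_nil
    · simp

theorem isLexMin_flatten (s : List {l : List (Fin n) // IsIndecomposable l}) :
    IsLexMin (s.map Subtype.val).flatten := by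
  induction s with
  | nil => exact isLexMin_nil
  | cons j s ih => simpa using j.2.isLexMin.append ih

theorem flatten_indecomposable_injective :
    Function.Injective fun s : List {l : List (Fin n) // IsIndecomposable l} =>
      (s.map Subtype.val).flatten := by
  intro s s' h
  induction s generalizing s' with
  | nil =>
    cases s' with
    | nil => rfl
    | cons j' s' => simp [j'.2.ne_nil] at h
  | cons j s ih =>
    cases s' with
    | nil => simp [j.2.ne_nil] at h
    | cons j' s' =>
      simp only [List.map_cons, List.flatten_cons] at h
      obtain ⟨h1, h2⟩ := j.2.append_inj j'.2 (isLexMin_flatten s) (isLexMin_flatten s') h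
      rw [Subtype.ext h1, ih h2]

theorem IsLexMin.exists_flatten_eq {l : List (Fin n)} (hl : IsLexMin l) :
    ∃ s : List {l : List (Fin n) // IsIndecomposable l}, (s.map Subtype.val).flatten = l := by
  induction hk : l.length using Nat.strong_induction_on generalizing l with
  | _ k ih =>
  by_cases h0 : l = []
  · exact ⟨[], by simp [h0]⟩
  by_cases hi : IsIndecomposable l
  · exact ⟨[⟨l, hi⟩], by simp⟩
  obtain ⟨u, v, rfl, hv, hu0, hv0⟩ : ∃ u v, l = u ++ v ∧ IsLexMin v ∧ u ≠ [] ∧ v ≠ [] := by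
    by_contra! hcon
    refine hi ⟨h0, hl, fun u v huv hv => ?_⟩
    by_contra! hne
    exact hne.2 (hcon u v huv hv hne.1)
  have hu1 := List.length_pos_iff.2 hu0
  have hv1 := List.length_pos_iff.2 hv0
  rw [List.length_append] at hk
  obtain ⟨s, hs⟩ := ih u.length (by omega) hl.of_append rfl
  obtain ⟨t, ht⟩ := ih v.length (by omega) hv rfl
  exact ⟨s ++ t, by rw [List.map_append, List.flatten_append, hs, ht]⟩

theorem exists_perm_of_ker_eq {ι' : Type*} {v v' : ι' → Fin n}
    (h : Setoid.ker v = Setoid.ker v') : ∃ σ : Equiv.Perm (Fin n), ∀ i, σ (v i) = v' i := by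
  have hiff : ∀ a b, v a = v b ↔ v' a = v' b := fun a b => by
    rw [← Setoid.ker_def, h, Setoid.ker_def]
  have : Finite (Quotient (Setoid.ker v)) := .of_injective _ (Setoid.kerLift_injective v)
  obtain ⟨σ, hσ⟩ := Equiv.Perm.exists_extending_pair (Setoid.kerLift v)
    (Quotient.lift v' fun a b hab => (hiff a b).1 hab) (Setoid.kerLift_injective v) (by
      rintro ⟨a⟩ ⟨b⟩ hab
      exact Quotient.sound ((hiff a b).2 hab))
  exact ⟨σ, fun i => hσ (Quotient.mk _ i)⟩

theorem card_isLexMin_ofFn (m n : ℕ) :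
    Nat.card {v : Fin m → Fin n // IsLexMin (List.ofFn v)} = bcount m n := by
  refine Nat.card_congr (Equiv.ofBijective (fun v => ⟨Setoid.ker v.1, ?_⟩) ⟨?_, ?_⟩)
  · simpa using Nat.card_le_card_of_injective _ (Setoid.kerLift_injective v.1)
  · rintro ⟨v, hv⟩ ⟨v', hv'⟩ h
    have h : Setoid.ker v = Setoid.ker v' := congrArg Subtype.val h
    obtain ⟨σ, hσ⟩ := exists_perm_of_ker_eq h
    obtain ⟨τ, hτ⟩ := exists_perm_of_ker_eq h.symm
    have h1 := hv σ
    have h2 := hv' τ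
    rw [List.map_ofFn, show ⇑σ ∘ v = v' from funext hσ] at h1
    rw [List.map_ofFn, show ⇑τ ∘ v' = v from funext hτ] at h2
    exact Subtype.ext (List.ofFn_injective (le_antisymm h1 h2))
  · rintro ⟨A, hA⟩
    obtain ⟨e⟩ : Nonempty (Quotient A ↪ Fin n) :=
      Function.Embedding.nonempty_of_card_le (by simpa [Nat.card_eq_fintype_card] using hA)
    obtain ⟨σ, hσ⟩ := Finite.exists_min fun σ : Equiv.Perm (Fin n) =>
      List.ofFn fun i => σ (e (Quotient.mk A i))
    refine ⟨⟨fun i => σ (e (Quotient.mk A i)), fun τ => ?_⟩, Subtype.ext (Setoid.ext fun a b => ?_)⟩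
    · rw [List.map_ofFn]
      exact hσ (τ * σ)
    · simp [Setoid.ker_def, Quotient.eq]

theorem card_isLexMin (m n : ℕ) :
    Nat.card {l : List (Fin n) // l.length = m ∧ IsLexMin l} = bcount m n := by
  rw [← card_isLexMin_ofFn]
  refine (Nat.card_congr (Equiv.ofBijective
    (fun v => ⟨List.ofFn v.1, List.length_ofFn, v.2⟩) ⟨fun v v' h => ?_, ?_⟩)).symm
  · exact Subtype.ext (List.ofFn_injective (congrArg Subtype.val h))
  · rintro ⟨l, rfl, hl⟩
    exact ⟨⟨l.get, by rwa [List.ofFn_get]⟩, Subtype.ext (List.ofFn_get l)⟩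

theorem finite_length_eq_and (m n : ℕ) (p : List (Fin n) → Prop) :
    Finite {l : List (Fin n) // l.length = m ∧ p l} :=
  ((List.finite_length_eq (Fin n) m).subset fun _ hl => hl.1).to_subtype

theorem bcount_zero (n : ℕ) : bcount 0 n = 1 := by
  rw [← card_isLexMin, Nat.card_eq_one_iff_unique]
  refine ⟨⟨fun a b => Subtype.ext ?_⟩, ⟨⟨[], rfl, isLexMin_nil⟩⟩⟩
  rw [List.length_eq_zero_iff.1 a.2.1, List.length_eq_zero_iff.1 b.2.1]

theorem bcount_eq_sum {m : ℕ} (n : ℕ) (hm : 1 ≤ m) :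
    bcount m n = ∑ i ∈ Finset.Icc 1 m,
      Nat.card {j : {l : List (Fin n) // IsIndecomposable l} // j.1.length = i} *
        bcount (m - i) n := by
  have hfin1 : ∀ i, Finite {j : {l : List (Fin n) // IsIndecomposable l} // j.1.length = i} :=
    fun i => by
      have := finite_length_eq_and i n IsIndecomposable
      exact .of_injective (fun j => (⟨j.1.1, j.2, j.1.2⟩ :
        {l : List (Fin n) // l.length = i ∧ IsIndecomposable l}))
        fun a b h => Subtype.ext (Subtype.ext (Subtype.ext_iff.1 h :))
  have hfin2 := fun i => finite_length_eq_and i n IsLexMin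
  rw [← Finset.sum_coe_sort]
  simp only [← card_isLexMin, ← Nat.card_prod]
  rw [← Nat.card_sigma]
  refine (Nat.card_congr (Equiv.ofBijective (fun x => ⟨x.2.1.1.1 ++ x.2.2.1, by
    have := (Finset.mem_Icc.1 x.1.2).2
    rw [List.length_append, x.2.1.2, x.2.2.2.1]
    omega, x.2.1.1.2.isLexMin.append x.2.2.2.2⟩) ⟨?_, ?_⟩)).symm
  · rintro ⟨⟨i, hi⟩, ⟨⟨j, hj⟩, hji⟩, ⟨l, hl, hl'⟩⟩ ⟨⟨i', hi'⟩, ⟨⟨j', hj'⟩, hji'⟩, ⟨k, hk, hk'⟩⟩ h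
    obtain ⟨rfl, rfl⟩ := hj.append_inj hj' hl' hk' (congrArg Subtype.val h)
    dsimp only at hji hji'
    subst hji hji'
    rfl
  · rintro ⟨l, rfl, hl⟩
    obtain ⟨_ | ⟨j, s⟩, rfl⟩ := hl.exists_flatten_eq
    · simp at hm
    · have := List.length_pos_iff.2 j.2.ne_nil
      refine ⟨⟨⟨j.1.length, Finset.mem_Icc.2 ⟨this, by simp⟩⟩, ⟨j, rfl⟩,
        ⟨(s.map Subtype.val).flatten, by simp, isLexMin_flatten s⟩⟩, ?_⟩
      simp

theorem card_isIndecomposable_eq (n : ℕ) (w : ℕ → ℕ)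
    (hw : ∀ m, 1 ≤ m → w m = bcount m n - ∑ i ∈ Finset.Ico 1 m, w i * bcount (m - i) n)
    (m : ℕ) (hm : 1 ≤ m) :
    Nat.card {j : {l : List (Fin n) // IsIndecomposable l} // j.1.length = m} = w m := by
  induction m using Nat.strong_induction_on with
  | _ m ih =>
  rw [hw m hm, bcount_eq_sum n hm, ← Finset.Ico_insert_right hm,
    Finset.sum_insert Finset.right_notMem_Ico, Nat.sub_self, bcount_zero, mul_one]
  refine (Nat.sub_eq_of_eq_add ?_).symm
  congr 1
  refine Finset.sum_congr rfl fun i hi => ?_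
  rw [ih i (Finset.mem_Ico.1 hi).2 (Finset.mem_Ico.1 hi).1]

end LexMin

section Invariants

open FreeAlgebra

variable {n : ℕ}

theorem act_monomial (σ : Equiv.Perm (Fin n)) (l : List (Fin n)) :
    act n σ (monomial l) = monomial (l.map σ) := by
  rw [act, lift_monomial, monomial, List.map_map]
  rfl

theorem act_act (σ τ : Equiv.Perm (Fin n)) (g : FreeAlgebra ℚ (Fin n)) :
    act n σ (act n τ g) = act n (σ * τ) g := by
  rw [← AlgHom.comp_apply]
  congr 1
  ext i
  simp [act]

theorem wordCoeff_act_map (σ : Equiv.Perm (Fin n)) (g : FreeAlgebra ℚ (Fin n))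
    (l : List (Fin n)) : wordCoeff (act n σ g) (l.map σ) = wordCoeff g l := by
  conv_lhs => rw [eq_sum_wordCoeff_smul_monomial g]
  conv_rhs => rw [eq_sum_wordCoeff_smul_monomial g]
  simp only [map_sum, map_smul, act_monomial, wordCoeff_sum, wordCoeff_smul, wordCoeff_monomial,
    (List.map_injective_iff.2 σ.injective).eq_iff]
  congr!

/-- The sum of the translates of a monomial under permutations of the variables. -/
def orbitSum (l : List (Fin n)) : FreeAlgebra ℚ (Fin n) :=
  ∑ σ : Equiv.Perm (Fin n), monomial (l.map σ)

theorem orbitSum_mem_NCSymAlg (l : List (Fin n)) : orbitSum l ∈ NCSymAlg n := by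
  intro τ
  simp only [orbitSum, ← act_monomial, map_sum, act_act]
  exact Equiv.sum_comp (Equiv.mulLeft τ) fun σ => act n σ (monomial l)

theorem orbitSum_mem_Vsub (l : List (Fin n)) : orbitSum l ∈ Vsub n l.length := by
  refine Submodule.sum_mem _ fun σ _ => Submodule.subset_span ⟨fun i => σ (l.get i), ?_⟩
  conv_rhs => rw [← List.ofFn_get l]
  simp only [word, monomial, List.map_ofFn]
  rfl

theorem leads_orbitSum {l : List (Fin n)} (hl : IsLexMin l) : Leads (orbitSum l) l := by
  simp only [Leads, orbitSum, wordCoeff_sum, wordCoeff_monomial]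
  constructor
  · intro u hu
    obtain ⟨σ, -, hσ⟩ := Finset.exists_ne_zero_of_sum_ne_zero hu
    obtain rfl : l.map σ = u := by
      by_contra h
      simp [h] at hσ
    exact ⟨by simp, hl σ⟩
  · refine (Finset.sum_pos' (fun σ _ => ?_) ⟨1, Finset.mem_univ _, by simp⟩).ne'
    split_ifs <;> simp

theorem isLexMin_of_mem_NCSymAlg {g : FreeAlgebra ℚ (Fin n)} (hg : g ∈ NCSymAlg n)
    {r : List (Fin n)} (hr : wordCoeff g r ≠ 0) (hmin : ∀ l, wordCoeff g l ≠ 0 → r ≤ l) :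
    IsLexMin r := fun σ => hmin _ <| by
  rwa [← hg σ, wordCoeff_act_map]

theorem range_lift_orbitSum :
    (lift ℚ fun j : {l : List (Fin n) // IsIndecomposable l} => orbitSum j.1).range =
      NCSymAlg n := by
  have hle : (lift ℚ fun j : {l : List (Fin n) // IsIndecomposable l} => orbitSum j.1).range ≤
      NCSymAlg n := by
    rw [← Algebra.adjoin_range_eq_range_freeAlgebra_lift, Algebra.adjoin_le_iff]
    rintro _ ⟨j, rfl⟩
    exact orbitSum_mem_NCSymAlg j.1
  refine le_antisymm hle ?_
  refine Subalgebra.toSubmodule.le_iff_le.1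
    (le_of_leads (Subalgebra.toSubmodule.le_iff_le.2 hle) ?_)
  refine fun g hg r hr hmin => ?_
  obtain ⟨s, rfl⟩ := (isLexMin_of_mem_NCSymAlg hg hr hmin).exists_flatten_eq
  refine ⟨_, ⟨monomial s, rfl⟩, ?_⟩
  simpa only [RingHom.coe_coe, AlgHom.toRingHom_eq_coe, lift_monomial] using
    Leads.list_prod (fun j : {l : List (Fin n) // IsIndecomposable l} =>
      leads_orbitSum j.2.isLexMin) s

end Invariants

end

/-- Wolf's theorem: `NCSym_n` is a free algebra, on a set of homogeneous invariant
generators with `w_{m,n}` generators in degree `m`, where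
`w_{m,n} = b_{m,n} − ∑_{i=1}^{m−1} w_{i,n} b_{m−i,n}`. -/
theorem stmt11 (n : ℕ) (hn : 1 ≤ n) (w : ℕ → ℕ)
    (hw : ∀ m, 1 ≤ m →
      w m = bcount m n - ∑ i ∈ Finset.Ico 1 m, w i * bcount (m - i) n) :
    ∃ (J : Type) (d : J → ℕ) (f : J → FreeAlgebra ℚ (Fin n)),
      (∀ j, 1 ≤ d j) ∧
      (∀ j, f j ∈ NCSymAlg n ∧ f j ∈ Vsub n (d j)) ∧
      Function.Injective ⇑(FreeAlgebra.lift ℚ f) ∧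
      (FreeAlgebra.lift ℚ f).range = NCSymAlg n ∧
      ∀ m, 1 ≤ m → Nat.card {j // d j = m} = w m := by
  exact ⟨{l : List (Fin n) // IsIndecomposable l}, fun j => j.1.length, fun j => orbitSum j.1,
    fun j => List.length_pos_iff.2 j.2.ne_nil,
    fun j => ⟨orbitSum_mem_NCSymAlg j.1, orbitSum_mem_Vsub j.1⟩,
    FreeAlgebra.lift_injective_of_leads (fun j => leads_orbitSum j.2.isLexMin)
      flatten_indecomposable_injective,
    range_lift_orbitSum, card_isIndecomposable_eq n w hw⟩
end
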